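/- arXiv:math/0603518 — 3 statements merged into one kernel-verified Lean document; each statement's English description precedes it below -/
import Mathlib

section
/- Let G be a finite abelian group, χ an irreducible character of G, H = ⟨h⟩ a cyclic subgroup, O_H the set of generators of H, F = H ∩ ker(χ), and Φ(H) the Frattini subgroup of H. Then χ(\underline{O_H}) = |Φ(H)| · μ(|H|/|F|) · φ(|F|/|Φ(H)|) whenever |H|/|F| is squarefree, and χ(\underline{O_H}) = 0 otherwise, where μ is the Möbius function and φ is Euler's totient function. -/
open ArithmeticFunction

/-- The kernel `{g | χ g = 1}` of a character `χ : G →* ℂ` of a group `G`, as a subgroup. -/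
def charKer {G : Type*} [Group G] (χ : G →* ℂ) : Subgroup G where
  carrier := {g | χ g = 1}
  one_mem' := map_one χ
  mul_mem' := by
    intro a b ha hb
    simp only [Set.mem_setOf_eq] at *
    rw [map_mul, ha, hb, one_mul]
  inv_mem' := by
    intro a ha
    simp only [Set.mem_setOf_eq] at *
    have h : χ a⁻¹ * χ a = 1 := by rw [← map_mul, inv_mul_cancel, map_one]
    rwa [ha, mul_one] at h

lemma aux_card {A : Type*} [Group A] [Finite A] (x : A) (K : Subgroup A) (d : ℕ)
    (hd : d ∣ orderOf x) (hK : K ≤ Subgroup.zpowers x) (h : ∀ k : ℕ, x ^ k ∈ K ↔ d ∣ k) :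
    Nat.card K = orderOf x / d := by
  have : K = Subgroup.zpowers (x ^ d) := by
    apply le_antisymm
    · intro y hy
      have hy' := hK hy
      rw [← mem_powers_iff_mem_zpowers] at hy'
      obtain ⟨k, rfl⟩ := hy'
      obtain ⟨j, rfl⟩ := (h k).1 hy
      exact ⟨j, by simp [pow_mul]⟩
    · rw [Subgroup.zpowers_le]
      exact (h d).2 dvd_rfl
  rw [this, Nat.card_zpowers, orderOf_pow, Nat.gcd_eq_right hd]

lemma aux_pow {A : Type*} [Group A] [Finite A] (x : A) (d k : ℕ)
    (hd : d ∣ orderOf x) : x ^ k ∈ Subgroup.zpowers (x ^ d) ↔ d ∣ k := by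
  constructor
  · intro h
    rw [← mem_powers_iff_mem_zpowers] at h
    obtain ⟨j, hj⟩ := h
    have hj' : x ^ (d * j) = x ^ k := by rw [pow_mul]; exact hj
    rw [pow_eq_pow_iff_modEq] at hj'
    exact ((hj'.of_dvd hd).dvd_iff dvd_rfl).1 (dvd_mul_right _ _)
  · rintro ⟨j, rfl⟩
    exact ⟨j, by simp [pow_mul]⟩

lemma aux_totient (r : ℕ) (hr : 0 < r) :
    ∑ e ∈ r.divisors, (moebius e : ℂ) * ((r / e : ℕ) : ℂ) = Nat.totient r := by
  have h1 := (ArithmeticFunction.sum_eq_iff_sum_mul_moebius_eq (R := ℂ)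
    (f := fun n => (Nat.totient n : ℂ)) (g := fun n => (n : ℂ))).1
    (fun n _ => by exact_mod_cast Nat.sum_totient n) r hr
  rw [← h1, Nat.sum_divisorsAntidiagonal (f := fun a b => (moebius a : ℂ) * (b : ℂ))]

lemma aux_inner (n d m : ℕ) (hn : 0 < n) (z : ℂ) (hm : orderOf z = m) (hmn : m ∣ n) (hd : d ∣ n) :
    ∑ k ∈ (Finset.range n).filter (d ∣ ·), z ^ k = if m ∣ d then ((n / d : ℕ) : ℂ) else 0 := by
  obtain ⟨e, rfl⟩ := hd
  have hd0 : 0 < d := Nat.pos_of_mul_pos_right hn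
  have h1 : ∑ k ∈ (Finset.range (d * e)).filter (d ∣ ·), z ^ k
      = ∑ j ∈ Finset.range e, (z ^ d) ^ j := by
    symm
    refine Finset.sum_bij (fun j _ => d * j) ?_ ?_ ?_ ?_
    · intro j hj
      simp only [Finset.mem_range, Finset.mem_filter] at *
      exact ⟨by gcongr, dvd_mul_right _ _⟩
    · intro a _ b _ h
      exact Nat.eq_of_mul_eq_mul_left hd0 h
    · intro b hb
      simp only [Finset.mem_range, Finset.mem_filter] at hb
      obtain ⟨hb, j, rfl⟩ := hb
      exact ⟨j, Finset.mem_range.2 (Nat.lt_of_mul_lt_mul_left hb), rfl⟩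
    · intro j _
      rw [pow_mul]
  rw [h1, Nat.mul_div_cancel_left _ hd0]
  split_ifs with h
  · rw [← hm, orderOf_dvd_iff_pow_eq_one] at h
    simp [h]
  · rw [← hm, orderOf_dvd_iff_pow_eq_one] at h
    rw [geom_sum_eq h, ← pow_mul, orderOf_dvd_iff_pow_eq_one.1 (hm ▸ hmn)]
    simp

lemma aux_ramanujan (n m : ℕ) (hn : 0 < n) (z : ℂ) (hm : orderOf z = m) (hmn : m ∣ n) :
    ∑ k ∈ (Finset.range n).filter (n.Coprime ·), z ^ k =
      ∑ d ∈ n.divisors, (moebius d : ℂ) * if m ∣ d then ((n / d : ℕ) : ℂ) else 0 := by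
  have h0 : ∀ k : ℕ, (if n.Coprime k then (1 : ℂ) else 0)
      = ∑ d ∈ n.divisors, if d ∣ k then (moebius d : ℂ) else 0 := by
    intro k
    have h1 : ∑ d ∈ (n.gcd k).divisors, (moebius d : ℂ) = if n.gcd k = 1 then 1 else 0 := by
      have := congrArg (fun f : ArithmeticFunction ℂ => f (n.gcd k))
        (coe_moebius_mul_coe_zeta (R := ℂ))
      simp only [coe_mul_zeta_apply, one_apply, intCoe_apply] at this
      exact this
    rw [← Finset.sum_filter]
    have h2 : n.divisors.filter (· ∣ k) = (n.gcd k).divisors := by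
      ext d
      simp [Nat.dvd_gcd_iff, hn.ne']
    rw [h2, h1]
  rw [Finset.sum_filter]
  calc _ = ∑ k ∈ Finset.range n, ∑ d ∈ n.divisors, (moebius d : ℂ) * (if d ∣ k then z ^ k else 0) := by
        refine Finset.sum_congr rfl fun k _ => ?_
        have : (if n.Coprime k then z ^ k else 0) = (if n.Coprime k then (1 : ℂ) else 0) * z ^ k := by
          split_ifs <;> simp
        rw [this, h0, Finset.sum_mul]
        refine Finset.sum_congr rfl fun d _ => ?_
        split_ifs <;> simp
    _ = _ := by
        rw [Finset.sum_comm]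
        refine Finset.sum_congr rfl fun d hd => ?_
        rw [← Finset.mul_sum, ← aux_inner n d m hn z hm hmn (Nat.dvd_of_mem_divisors hd),
          Finset.sum_filter]

lemma aux_formula (n m : ℕ) (hn : 0 < n) (hmn : m ∣ n) (hsq : Squarefree m) :
    (∑ d ∈ n.divisors, (moebius d : ℂ) * if m ∣ d then ((n / d : ℕ) : ℂ) else 0) =
    ((n / UniqueFactorizationMonoid.radical n : ℕ) : ℂ) * (moebius m : ℂ) *
      (Nat.totient ((n / m) / (n / UniqueFactorizationMonoid.radical n)) : ℂ) := by
  set R := UniqueFactorizationMonoid.radical n with hR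
  have hRsq : Squarefree R := UniqueFactorizationMonoid.squarefree_radical
  have hRn : R ∣ n := UniqueFactorizationMonoid.radical_dvd_self
  have hdR : ∀ d, Squarefree d → d ∣ n → d ∣ R := fun d h1 h2 =>
    (UniqueFactorizationMonoid.dvd_radical_iff h1.isRadical hn.ne').2 h2
  obtain ⟨r, hr⟩ := hdR m hsq hmn
  obtain ⟨q, hq⟩ := hRn
  have hq0 : 0 < q := Nat.pos_of_ne_zero (by rintro rfl; simp at hq; omega)
  have hR0 : 0 < R := Nat.pos_of_ne_zero (by intro h; simp [h] at hq; omega)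
  have hm0 : 0 < m := Nat.pos_of_ne_zero (by rintro rfl; simp at hr; omega)
  have hr0 : 0 < r := Nat.pos_of_ne_zero (by rintro rfl; simp at hr; omega)
  have e1 : n / R = q := by rw [hq, Nat.mul_div_cancel_left _ hR0]
  have e2 : n / m / q = r := by
    rw [hq, hr, mul_assoc, Nat.mul_div_cancel_left _ hm0, Nat.mul_div_cancel _ hq0]
  rw [e1, e2, ← aux_totient r hr0, Finset.mul_sum]
  symm
  have hinj : Function.Injective (fun e : ℕ => m * e) := fun a b h => Nat.eq_of_mul_eq_mul_left hm0 h
  rw [hr] at hRsq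
  have hcop := Nat.coprime_of_squarefree_mul hRsq
  calc _ = ∑ e ∈ r.divisors, (moebius (m * e) : ℂ) *
          if m ∣ m * e then ((n / (m * e) : ℕ) : ℂ) else 0 := by
        refine Finset.sum_congr rfl fun e he => ?_
        obtain ⟨f, hf⟩ := Nat.dvd_of_mem_divisors he
        have he0 : 0 < e := Nat.pos_of_mem_divisors he
        rw [if_pos (dvd_mul_right _ _), isMultiplicative_moebius.map_mul_of_coprime
          (hcop.coprime_dvd_right ⟨f, hf⟩)]
        have : n / (m * e) = f * q := by
          rw [hq, hr, hf, show m * (e * f) * q = (m * e) * (f * q) by ring,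
            Nat.mul_div_cancel_left _ (by positivity)]
        rw [this, hf, Nat.mul_div_cancel_left _ he0]
        push_cast
        ring
    _ = ∑ d ∈ r.divisors.map ⟨_, hinj⟩, (moebius d : ℂ) *
          if m ∣ d then ((n / d : ℕ) : ℂ) else 0 := by
        rw [Finset.sum_map]; rfl
    _ = _ := by
        refine Finset.sum_subset ?_ ?_
        · intro d hd
          simp only [Finset.mem_map, Function.Embedding.coeFn_mk] at hd
          obtain ⟨e, he, rfl⟩ := hd
          rw [Nat.mem_divisors]
          refine ⟨?_, hn.ne'⟩
          rw [hq, hr]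
          exact Dvd.dvd.mul_right (mul_dvd_mul_left _ (Nat.dvd_of_mem_divisors he)) _
        · intro d hd hd'
          by_cases hmd : m ∣ d
          · by_cases hs : Squarefree d
            · exfalso
              apply hd'
              obtain ⟨e, rfl⟩ := hmd
              have := hdR _ hs (Nat.dvd_of_mem_divisors hd)
              rw [hr] at this
              simp only [Finset.mem_map, Function.Embedding.coeFn_mk]
              exact ⟨e, Nat.mem_divisors.2 ⟨Nat.dvd_of_mul_dvd_mul_left hm0 this, hr0.ne'⟩, rfl⟩
            · simp [moebius_eq_zero_of_not_squarefree hs]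
          · simp [hmd]

lemma aux_formula0 (n m : ℕ) (hsq : ¬ Squarefree m) :
    (∑ d ∈ n.divisors, (moebius d : ℂ) * if m ∣ d then ((n / d : ℕ) : ℂ) else 0) = 0 := by
  refine Finset.sum_eq_zero fun d _ => ?_
  split_ifs with h
  · rw [moebius_eq_zero_of_not_squarefree fun hd => hsq (hd.squarefree_of_dvd h)]
    simp
  · simp

lemma aux_frattini {A : Type*} [Group A] [Finite A] (x : A) (hx : Subgroup.zpowers x = ⊤) :
    Nat.card (frattini A) = orderOf x / UniqueFactorizationMonoid.radical (orderOf x) := by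
  have hn : 0 < orderOf x := orderOf_pos x
  refine aux_card x _ _ UniqueFactorizationMonoid.radical_dvd_self (hx ▸ le_top) fun k => ?_
  have hall : ∀ y : A, ∃ k : ℕ, x ^ k = y := fun y => by
    have : y ∈ Subgroup.zpowers x := hx ▸ Subgroup.mem_top y
    rwa [← mem_powers_iff_mem_zpowers] at this
  constructor
  · intro h
    by_cases hk : k = 0
    · simp [hk]
    rw [Nat.radical_dvd_iff hk]
    intro p hp
    have hpp := Nat.prime_of_mem_primeFactors hp
    have hpn := Nat.dvd_of_mem_primeFactors hp
    refine Nat.mem_primeFactors.2 ⟨hpp, ?_, hk⟩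
    rw [← aux_pow x p k hpn]
    refine frattini_le_coatom ⟨?_, ?_⟩ h
    · intro htop
      have : x ^ 1 ∈ Subgroup.zpowers (x ^ p) := htop ▸ Subgroup.mem_top _
      rw [aux_pow x p 1 hpn] at this
      exact hpp.one_lt.ne' (Nat.dvd_one.1 this)
    · intro K hK
      obtain ⟨hle, y, hy, hy'⟩ := SetLike.lt_iff_le_and_exists.1 hK
      obtain ⟨j, rfl⟩ := hall y
      rw [aux_pow x p j hpn] at hy'
      rw [eq_top_iff, ← hx, Subgroup.zpowers_le]
      have hc : Nat.gcd p j = 1 := (Nat.Prime.coprime_iff_not_dvd hpp).2 hy'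
      have hp' : x ^ p ∈ K := hle (Subgroup.mem_zpowers _)
      have : x = (x ^ p) ^ (Nat.gcdA p j) * (x ^ j) ^ (Nat.gcdB p j) := by
        rw [← zpow_natCast, ← zpow_natCast, ← zpow_mul, ← zpow_mul, ← zpow_add,
          ← Nat.gcd_eq_gcd_ab, hc]
        simp
      rw [this]
      exact K.mul_mem (K.zpow_mem hp' _) (K.zpow_mem hy _)
  · intro h
    have hrad : x ^ k ∈ (⨅ K ∈ {K : Subgroup A | IsCoatom K}, K) := by
      simp only [Subgroup.mem_iInf]
      intro K hK
      have hi : K.index ≠ 1 := fun h => hK.1 (Subgroup.index_eq_one.1 h)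
      obtain ⟨p, hp, hpi⟩ := Nat.exists_prime_and_dvd hi
      have hcard : Nat.card A = orderOf x := by
        rw [← Nat.card_zpowers, hx, Subgroup.card_top]
      have hpn : p ∣ orderOf x := by
        rw [← hcard]; exact hpi.trans K.index_dvd_card
      have hKle : K ≤ Subgroup.zpowers (x ^ p) := by
        intro y hy
        obtain ⟨j, rfl⟩ := hall y
        rw [aux_pow x p j hpn]
        have h1 : (x ^ j) ^ Nat.card K = 1 := by
          have := pow_card_eq_one' (x := (⟨x ^ j, hy⟩ : K))
          exact congrArg Subtype.val this
        rw [← pow_mul, ← orderOf_dvd_iff_pow_eq_one, ← hcard, ← K.card_mul_index, mul_comm j] at h1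
        exact hpi.trans (Nat.dvd_of_mul_dvd_mul_left Nat.card_pos h1)
      have hKeq : K = Subgroup.zpowers (x ^ p) := by
        rcases hKle.eq_or_lt with h | h
        · exact h
        · exfalso
          have htop := hK.2 _ h
          have : x ^ 1 ∈ Subgroup.zpowers (x ^ p) := htop ▸ Subgroup.mem_top _
          rw [aux_pow x p 1 hpn] at this
          exact hp.one_lt.ne' (Nat.dvd_one.1 this)
      rw [hKeq, aux_pow x p k hpn]
      exact ((UniqueFactorizationMonoid.dvd_radical_iff hp.prime.isRadical hn.ne').2 hpn).trans h
    exact hrad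

lemma aux_sum {G : Type*} [CommGroup G] [Fintype G] (χ : G →* ℂ) (h : G) :
    ∑ᶠ g ∈ {g : G | Subgroup.zpowers g = Subgroup.zpowers h}, χ g =
    ∑ k ∈ (Finset.range (orderOf h)).filter ((orderOf h).Coprime ·), χ h ^ k := by
  classical
  have hset : {g : G | Subgroup.zpowers g = Subgroup.zpowers h} =
      (((Finset.range (orderOf h)).filter ((orderOf h).Coprime ·)).image (h ^ ·) : Finset G) := by
    ext g
    simp only [Set.mem_ofPred_eq, Finset.coe_image, Set.mem_image, Finset.coe_filter,
      Finset.mem_range]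
    constructor
    · intro hg
      have : g ∈ Subgroup.zpowers h := hg ▸ Subgroup.mem_zpowers g
      rw [mem_zpowers_iff_mem_range_orderOf] at this
      simp only [Finset.mem_image, Finset.mem_range] at this
      obtain ⟨k, hk, rfl⟩ := this
      exact ⟨k, ⟨hk, Nat.Coprime.symm (mem_zpowers_pow_iff.1 (hg ▸ Subgroup.mem_zpowers h))⟩, rfl⟩
    · rintro ⟨k, ⟨_, hk⟩, rfl⟩
      apply le_antisymm
      · exact Subgroup.zpowers_le.2 (Subgroup.pow_mem _ (Subgroup.mem_zpowers h) _)
      · exact Subgroup.zpowers_le.2 (mem_zpowers_pow_iff.2 hk.symm)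
  rw [hset, finsum_mem_coe_finset, Finset.sum_image]
  · simp
  · intro a ha b hb hab
    simp only [Finset.coe_filter, Finset.mem_range, Set.mem_ofPred_eq] at ha hb
    exact pow_injOn_Iio_orderOf ha.1 hb.1 hab

/-- let `G` be a finite abelian group, `χ` an irreducible character of `G`,
`H = ⟨h⟩` a cyclic subgroup with generator set `O_H`, `F = H ∩ ker χ` and `Φ(H)` the
Frattini subgroup of `H`.  Then `χ(O_H) = |Φ(H)| · μ(|H|/|F|) · φ(|F|/|Φ(H)|)` when
`|H|/|F|` is squarefree, and `χ(O_H) = 0` otherwise. -/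
theorem stmt_5 {G : Type*} [CommGroup G] [Fintype G] (χ : G →* ℂ) (h : G) :
    (Squarefree (Nat.card (Subgroup.zpowers h) /
        Nat.card (Subgroup.zpowers h ⊓ charKer χ : Subgroup G)) →
      ∑ᶠ g ∈ {g : G | Subgroup.zpowers g = Subgroup.zpowers h}, χ g =
        (Nat.card (frattini (Subgroup.zpowers h)) : ℂ) *
          (moebius (Nat.card (Subgroup.zpowers h) /
            Nat.card (Subgroup.zpowers h ⊓ charKer χ : Subgroup G)) : ℂ) *
          (Nat.totient (Nat.card (Subgroup.zpowers h ⊓ charKer χ : Subgroup G) /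
            Nat.card (frattini (Subgroup.zpowers h))) : ℂ)) ∧
    (¬ Squarefree (Nat.card (Subgroup.zpowers h) /
        Nat.card (Subgroup.zpowers h ⊓ charKer χ : Subgroup G)) →
      ∑ᶠ g ∈ {g : G | Subgroup.zpowers g = Subgroup.zpowers h}, χ g = 0) := by
  have hn : 0 < orderOf h := orderOf_pos h
  have hm : orderOf (χ h) ∣ orderOf h := orderOf_map_dvd χ h
  have hF : Nat.card (Subgroup.zpowers h ⊓ charKer χ : Subgroup G) =
      orderOf h / orderOf (χ h) := by
    refine aux_card h _ _ hm inf_le_left fun k => ?_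
    rw [orderOf_dvd_iff_pow_eq_one, ← map_pow]
    constructor
    · intro hk
      exact hk.2
    · intro hk
      exact ⟨Subgroup.pow_mem _ (Subgroup.mem_zpowers h) _, hk⟩
  have hΦ : Nat.card (frattini (Subgroup.zpowers h)) =
      orderOf h / UniqueFactorizationMonoid.radical (orderOf h) := by
    have := aux_frattini (⟨h, Subgroup.mem_zpowers h⟩ : Subgroup.zpowers h) (by
      rw [eq_top_iff]
      rintro ⟨y, k, hk⟩ -
      exact ⟨k, Subtype.ext (by simpa using hk)⟩)
    rwa [Subgroup.orderOf_mk] at this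
  rw [hF, hΦ, Nat.card_zpowers, Nat.div_div_self hm hn.ne', aux_sum,
    aux_ramanujan (orderOf h) (orderOf (χ h)) hn (χ h) rfl hm]
  exact ⟨fun hs => aux_formula _ _ hn hm hs, fun hs => aux_formula0 _ _ hs⟩
end

section
/- Let p be a prime, n ≥ 1, and G = Z_{p^n} ⊕ Z_{p^n}. Let S ⊆ Δ be an (a_1, a_2, ..., a_2)-homogeneous set (constant tail a_2 = a_3 = ··· = a_n). Then for every non-principal irreducible character χ of G with kernel H (a cocyclic subgroup), χ applied to the simple quantity [S] = ∑_{F∈S} \underline{O_F} equals -∑_{i=1}^{n} a_i p^{i-1} + δ·p^n, where δ = 1 if H^Δ ∈ S and δ = 0 otherwise; in particular [S] takes exactly the two values s and s + p^n on non-principal characters, with s = -a_1 - a_2(p^n - p)/(p - 1). -/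
section
variable (p n : ℕ)

/-- A subgroup is cyclic (member of the poset `Δ`). -/
def IsCyc (H : AddSubgroup (ZMod (p ^ n) × ZMod (p ^ n))) : Prop :=
  ∃ x, H = AddSubgroup.zmultiples x

/-- `Father(H) = pH`. -/
def father (H : AddSubgroup (ZMod (p ^ n) × ZMod (p ^ n))) :
    AddSubgroup (ZMod (p ^ n) × ZMod (p ^ n)) :=
  H.map (AddMonoidHom.mk' (fun x => p • x) (fun a b => smul_add _ a b))

/-- `l(K) = log_p |K|`. -/
noncomputable def len (K : AddSubgroup (ZMod (p ^ n) × ZMod (p ^ n))) : ℕ :=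
  (Nat.card K).factorization p

/-- `S ⊆ Δ` is `(a 1, ..., a n)`-homogeneous. -/
def IsHomog (S : Set (AddSubgroup (ZMod (p ^ n) × ZMod (p ^ n)))) (a : ℕ → ℕ) : Prop :=
  (⊥ : AddSubgroup (ZMod (p ^ n) × ZMod (p ^ n))) ∉ S ∧
  ∀ H, IsCyc p n H → len p n H < n →
    (H ∈ S → Nat.card {F : AddSubgroup (ZMod (p ^ n) × ZMod (p ^ n)) //
        IsCyc p n F ∧ father p n F = H ∧ F ∈ S} = a (len p n H + 1) + 1) ∧
    (H ∉ S → Nat.card {F : AddSubgroup (ZMod (p ^ n) × ZMod (p ^ n)) //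
        IsCyc p n F ∧ father p n F = H ∧ F ∈ S} = a (len p n H + 1))

/-- The multiplication-by-`pᵏ` endomorphism. -/
def pPow (k : ℕ) : (ZMod (p ^ n) × ZMod (p ^ n)) →+ (ZMod (p ^ n) × ZMod (p ^ n)) :=
  AddMonoidHom.mk' (fun x => p ^ k • x) (fun a b => smul_add _ a b)

/-- For a cocyclic subgroup `H ≅ ℤ_{pⁿ} ⊕ ℤ_{pᵐ}` (so `|H| = p^{n+m}`), `H^Δ = pᵐ H`. -/
noncomputable def deltaMap (H : AddSubgroup (ZMod (p ^ n) × ZMod (p ^ n))) :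
    AddSubgroup (ZMod (p ^ n) × ZMod (p ^ n)) :=
  H.map (pPow p n (len p n H - n))

end

theorem zz_pow_mul_eq_zero_iff (p : ℕ) (hp : p.Prime) (n : ℕ) [NeZero (p ^ n)] (j : ℕ) (hj : j ≤ n)
    (r : ZMod (p ^ n)) : (p : ZMod (p ^ n)) ^ j * r = 0 ↔ (p : ZMod (p ^ n)) ^ (n - j) ∣ r := by
  have hpn : (p : ZMod (p ^ n)) ^ n = 0 := by
    have := ZMod.natCast_self (p ^ n)
    rwa [Nat.cast_pow] at this
  constructor
  · intro h
    have h1 : ((p ^ j * r.val : ℕ) : ZMod (p ^ n)) = 0 := by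
      push_cast; rw [ZMod.natCast_zmod_val]; exact h
    rw [ZMod.natCast_eq_zero_iff] at h1
    have h2 : p ^ (n - j) ∣ r.val := by
      have h3 : p ^ n = p ^ j * p ^ (n - j) := by rw [← pow_add]; congr 1; omega
      exact Nat.dvd_of_mul_dvd_mul_left (pow_pos hp.pos j) (h3 ▸ h1 : p ^ j * p ^ (n - j) ∣ _)
    obtain ⟨c, hc⟩ := h2
    refine ⟨c, ?_⟩
    rw [← ZMod.natCast_zmod_val r, hc]; push_cast; rfl
  · rintro ⟨c, rfl⟩
    rw [← mul_assoc, ← pow_add, Nat.add_sub_cancel' hj, hpn, zero_mul]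

theorem zz_isUnit_iff (p : ℕ) (hp : p.Prime) (n : ℕ) (hn : 1 ≤ n) [NeZero (p ^ n)]
    (r : ZMod (p ^ n)) : IsUnit r ↔ ¬ (p : ZMod (p ^ n)) ∣ r := by
  have hd : p ∣ r.val ↔ (p : ZMod (p ^ n)) ∣ r := by
    constructor
    · rintro ⟨c, hc⟩
      refine ⟨c, ?_⟩
      rw [← ZMod.natCast_zmod_val r, hc]; push_cast; rfl
    · rintro ⟨c, hc⟩
      have h1 : ((r.val : ℕ) : ZMod (p ^ n)) = ((p * c.val : ℕ) : ZMod (p ^ n)) := by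
        push_cast; rw [ZMod.natCast_zmod_val, ZMod.natCast_zmod_val]; exact hc
      rw [ZMod.natCast_eq_natCast_iff] at h1
      have h2 := (h1.of_dvd (dvd_pow_self p (by omega : n ≠ 0)))
      exact (h2.dvd_iff dvd_rfl).2 (dvd_mul_right _ _)
  rw [← hd]
  conv_lhs => rw [← ZMod.natCast_zmod_val r]
  rw [ZMod.isUnit_iff_coprime, Nat.coprime_pow_right_iff (by omega), Nat.coprime_comm,
    hp.coprime_iff_not_dvd]

theorem zz_count0 (p : ℕ) (hp : p.Prime) (n : ℕ) [NeZero (p ^ n)] (j : ℕ) (hj : j ≤ n) :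
    (∑ r : ZMod (p ^ n), if (p : ZMod (p ^ n)) ^ j * r = 0 then (1 : ℂ) else 0) = (p : ℂ) ^ j := by
  have h := IsCyclic.card_powMonoidHom_ker (G := Multiplicative (ZMod (p ^ n))) (p ^ j)
  have h0 : Nat.card (Multiplicative (ZMod (p ^ n))) = p ^ n := by simp
  rw [h0, Nat.gcd_eq_right (pow_dvd_pow p hj)] at h
  rw [← Finset.sum_filter, Finset.sum_const, nsmul_eq_mul, mul_one]
  refine Eq.trans ?_ (Nat.cast_pow p j)
  refine congrArg _ (Eq.trans ?_ h)
  rw [← Nat.card_eq_finsetCard]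
  refine Nat.card_congr (Equiv.subtypeEquiv Multiplicative.ofAdd ?_)
  intro r
  rw [Finset.mem_filter, MonoidHom.mem_ker, powMonoidHom_apply, ← ofAdd_nsmul, ofAdd_eq_one]
  simp [nsmul_eq_mul]

theorem zz_count (p : ℕ) (hp : p.Prime) (n : ℕ) [NeZero (p ^ n)] (j : ℕ) (hj : j ≤ n)
    (r₀ : ZMod (p ^ n)) :
    (∑ r : ZMod (p ^ n), if (p : ZMod (p ^ n)) ^ j * r = (p : ZMod (p ^ n)) ^ j * r₀
      then (1 : ℂ) else 0) = (p : ℂ) ^ j := by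
  rw [← zz_count0 p hp n j hj, ← Equiv.sum_comp (Equiv.addRight r₀)]
  refine Finset.sum_congr rfl fun r _ => ?_
  simp [mul_add]

/-- sum over fibres of multiplication by `p`. -/
theorem zz_fib (p : ℕ) (hp : p.Prime) (n : ℕ) (hn : 1 ≤ n) [NeZero (p ^ n)]
    (F : ZMod (p ^ n) → ℂ) :
    ∑ r : ZMod (p ^ n), F (p * r) =
      p * ∑ r : ZMod (p ^ n), if IsUnit r then 0 else F r := by
  classical
  have h1 : ∀ r : ZMod (p ^ n), F (p * r) = ∑ c : ZMod (p ^ n), if (p : ZMod (p ^ n)) * r = c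
      then F c else 0 := by
    intro r; simp
  rw [Finset.sum_congr rfl fun r _ => h1 r, Finset.sum_comm, Finset.mul_sum]
  refine Finset.sum_congr rfl fun c _ => ?_
  have h2 : (∑ r : ZMod (p ^ n), if (p : ZMod (p ^ n)) * r = c then F c else 0) =
      F c * ∑ r : ZMod (p ^ n), if (p : ZMod (p ^ n)) * r = c then 1 else 0 := by
    rw [Finset.mul_sum]
    refine Finset.sum_congr rfl fun r _ => ?_
    split_ifs <;> simp
  rw [h2]
  have hu := zz_isUnit_iff p hp n hn c
  by_cases hc : (p : ZMod (p ^ n)) ∣ c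
  · obtain ⟨c₀, rfl⟩ := hc
    have := zz_count p hp n 1 hn c₀
    simp only [pow_one] at this
    rw [this, if_neg (by rw [hu]; simp)]; ring
  · rw [if_pos (hu.2 hc), mul_zero, Finset.sum_eq_zero, mul_zero]
    intro r _
    rw [if_neg]
    rintro rfl
    exact hc (dvd_mul_right _ _)

theorem zz_units_sum (p n : ℕ) [NeZero (p ^ n)] (F : ZMod (p ^ n) → ℂ) :
    ∑ u : (ZMod (p ^ n))ˣ, F u =
      ∑ r : ZMod (p ^ n), if IsUnit r then F r else 0 := by
  classical
  rw [← Finset.sum_filter]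
  refine Finset.sum_bij (fun u _ => (u : ZMod (p ^ n))) ?_ ?_ ?_ ?_
  · intro u _; simp
  · intro u _ v _ h; exact Units.ext h
  · intro r hr
    obtain ⟨u, hu⟩ := (Finset.mem_filter.1 hr).2
    exact ⟨u, Finset.mem_univ _, hu⟩
  · intro u _; rfl

theorem zz_ram (p : ℕ) (hp : p.Prime) (n : ℕ) (hn : 1 ≤ n) [NeZero (p ^ n)]
    (e : AddChar (ZMod (p ^ n)) ℂ) (he : e.IsPrimitive) (z : ZMod (p ^ n)) :
    (p : ℂ) * ∑ u : (ZMod (p ^ n))ˣ, e (u * z) =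
      (p : ℂ) ^ n * ((p : ℂ) * (if z = 0 then 1 else 0) - (if (p : ZMod (p ^ n)) * z = 0 then 1 else 0)) := by
  classical
  have h1 := AddChar.sum_mulShift z he
  have h2 := AddChar.sum_mulShift (p * z) he
  have h3 := zz_fib p hp n hn (fun r => e (r * z))
  rw [zz_units_sum p n (fun r => e (r * z))]
  have h4 : (∑ r : ZMod (p ^ n), if IsUnit r then e (r * z) else 0) +
      (∑ r : ZMod (p ^ n), if IsUnit r then 0 else e (r * z)) = ∑ r : ZMod (p ^ n), e (r * z) := by
    rw [← Finset.sum_add_distrib]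
    refine Finset.sum_congr rfl fun r _ => ?_
    split_ifs <;> simp
  have h5 : ∑ r : ZMod (p ^ n), e (p * r * z) = ∑ r : ZMod (p ^ n), e (r * (p * z)) :=
    Finset.sum_congr rfl fun r _ => by congr 1; ring
  rw [h5, h2] at h3
  rw [h1] at h4
  rw [ZMod.card] at h3 h4
  have h6 := congrArg (fun t => (p : ℂ) * t) h4
  simp only [mul_add] at h6
  rw [← h3] at h6
  rw [eq_sub_of_add_eq h6]
  push_cast
  split_ifs <;> simp <;> ring

theorem zz_char (p n : ℕ) [NeZero (p ^ n)] (ψ : AddChar (ZMod (p ^ n)) ℂ) :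
    ∃ α : ZMod (p ^ n), ∀ r, ψ r = ZMod.stdAddChar (α * r) := by
  have hinj := AddChar.to_mulShift_inj_of_isPrimitive (ZMod.isPrimitive_stdAddChar (p ^ n))
  have hb := (Fintype.bijective_iff_injective_and_card _).2 ⟨hinj, by rw [AddChar.card_eq]⟩
  obtain ⟨α, h⟩ := hb.2 ψ
  exact ⟨α, fun r => by rw [← h, AddChar.mulShift_apply]⟩

theorem zz_fiber {G : Type*} [Fintype G] [DecidableEq G] (φ : G → G) (g f : G → ℂ) :
    ∑ y, g (φ y) * f y = ∑ x, g x * ∑ y, if φ y = x then f y else 0 := by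
  simp_rw [Finset.mul_sum]
  rw [Finset.sum_comm]
  refine Finset.sum_congr rfl fun y _ => ?_
  simp

/-- if `p^j r = 0` with `j < n` then `p ∣ r`. -/
theorem zz_dvd_of (p : ℕ) (hp : p.Prime) (n : ℕ) [NeZero (p ^ n)] (j : ℕ) (hj : j < n)
    (r : ZMod (p ^ n)) (h : (p : ZMod (p ^ n)) ^ j * r = 0) : (p : ZMod (p ^ n)) ∣ r :=
  (dvd_pow_self _ (by omega : n - j ≠ 0)).trans
    ((zz_pow_mul_eq_zero_iff p hp n j hj.le r).1 h)

theorem zz_pow_ne (p : ℕ) (hp : p.Prime) (n : ℕ) (m : ℕ) (hm : m < n) :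
    (p : ZMod (p ^ n)) ^ m ≠ 0 := by
  intro h
  rw [← Nat.cast_pow, ZMod.natCast_eq_zero_iff, Nat.pow_dvd_pow_iff_le_right hp.one_lt] at h
  omega

set_option maxHeartbeats 1000000 in
/-- counting iterated preimages of `(0, p^m)` weighted by `f`. -/
theorem zz_iter (p : ℕ) (hp : p.Prime) (n : ℕ) [NeZero (p ^ n)] (m : ℕ) (hm : m < n)
    (f : ZMod (p ^ n) × ZMod (p ^ n) → ℂ) (a₂ : ℂ)
    (hN : ∀ x : ZMod (p ^ n) × ZMod (p ^ n), (p : ZMod (p ^ n)) ∣ x.1 → (p : ZMod (p ^ n)) ∣ x.2 →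
      x ≠ 0 → (∑ y, if (p : ZMod (p ^ n)) • y = x then f y else 0) = p * (a₂ + f x))
    (j : ℕ) (hj : j ≤ m) :
    (∑ y, if (p : ZMod (p ^ n)) ^ j • y = ((0 : ZMod (p ^ n)), (p : ZMod (p ^ n)) ^ m) then f y else 0) =
      (p : ℂ) ^ j * (f (0, (p : ZMod (p ^ n)) ^ m) + a₂ * ∑ i ∈ Finset.range j, (p : ℂ) ^ i) := by
  induction j with
  | zero => simp
  | succ j ih =>
    have ih := ih (by omega)
    have h1 := zz_fiber (fun y : ZMod (p ^ n) × ZMod (p ^ n) => (p : ZMod (p ^ n)) • y)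
      (fun z => if (p : ZMod (p ^ n)) ^ j • z = ((0 : ZMod (p ^ n)), (p : ZMod (p ^ n)) ^ m) then 1 else 0) f
    have h2 : (∑ y, if (p : ZMod (p ^ n)) ^ (j + 1) • y = ((0 : ZMod (p ^ n)), (p : ZMod (p ^ n)) ^ m) then f y else 0)
        = ∑ y, (if (p : ZMod (p ^ n)) ^ j • (p : ZMod (p ^ n)) • y = ((0 : ZMod (p ^ n)), (p : ZMod (p ^ n)) ^ m) then 1 else 0) * f y := by
      refine Finset.sum_congr rfl fun y _ => ?_
      rw [smul_smul, ← pow_succ, ite_mul, one_mul, zero_mul]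
    rw [h2, h1]
    have hpm : (p : ZMod (p ^ n)) ^ m = (p : ZMod (p ^ n)) ^ j * (p : ZMod (p ^ n)) ^ (m - j) := by
      rw [← pow_add]; congr 1; omega
    have h3 : ∀ z : ZMod (p ^ n) × ZMod (p ^ n),
        (if (p : ZMod (p ^ n)) ^ j • z = ((0 : ZMod (p ^ n)), (p : ZMod (p ^ n)) ^ m) then (1 : ℂ) else 0) *
          (∑ y, if (p : ZMod (p ^ n)) • y = z then f y else 0) =
        p * a₂ * (if (p : ZMod (p ^ n)) ^ j • z = ((0 : ZMod (p ^ n)), (p : ZMod (p ^ n)) ^ m) then 1 else 0) +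
        p * (if (p : ZMod (p ^ n)) ^ j • z = ((0 : ZMod (p ^ n)), (p : ZMod (p ^ n)) ^ m) then f z else 0) := by
      intro z
      split_ifs with hz
      · have hz1 : (p : ZMod (p ^ n)) ^ j * z.1 = 0 := congrArg Prod.fst hz
        have hz2 : (p : ZMod (p ^ n)) ^ j * z.2 = (p : ZMod (p ^ n)) ^ m := congrArg Prod.snd hz
        rw [hN z (zz_dvd_of p hp n j (by omega) _ hz1) ?_ ?_]
        · ring
        · have h4 : (p : ZMod (p ^ n)) ^ j * (z.2 - (p : ZMod (p ^ n)) ^ (m - j)) = 0 := by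
            rw [mul_sub, hz2, ← hpm, sub_self]
          have h5 := zz_dvd_of p hp n j (by omega) _ h4
          have h6 := dvd_add h5 (dvd_pow_self (p : ZMod (p ^ n)) (by omega : m - j ≠ 0))
          simpa using h6
        · rintro rfl
          exact zz_pow_ne p hp n m hm (by simpa using hz2.symm)
      · simp
    have hcount : (∑ z : ZMod (p ^ n) × ZMod (p ^ n),
        if (p : ZMod (p ^ n)) ^ j • z = ((0 : ZMod (p ^ n)), (p : ZMod (p ^ n)) ^ m) then (1 : ℂ) else 0)
          = (p : ℂ) ^ j * (p : ℂ) ^ j := by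
      have e1 := zz_count0 p hp n j (by omega)
      have e2 := zz_count p hp n j (by omega) ((p : ZMod (p ^ n)) ^ (m - j))
      rw [← hpm] at e2
      refine Eq.trans ?_ (congrArg₂ (· * ·) e1 e2)
      rw [Finset.sum_mul_sum, Fintype.sum_prod_type]
      refine Finset.sum_congr rfl fun s _ => Finset.sum_congr rfl fun t _ => ?_
      simp only [Prod.smul_mk, Prod.mk.injEq, smul_eq_mul]
      by_cases q1 : (p : ZMod (p ^ n)) ^ j * s = 0
      · by_cases q2 : (p : ZMod (p ^ n)) ^ j * t = (p : ZMod (p ^ n)) ^ m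
        · rw [if_pos q1, if_pos q2, if_pos ⟨q1, q2⟩, one_mul]
        · rw [if_neg q2, if_neg (fun h => q2 h.2), mul_zero]
      · rw [if_neg q1, if_neg (fun h => q1 h.1), zero_mul]
    rw [Finset.sum_congr rfl fun z _ => h3 z, Finset.sum_add_distrib, ← Finset.mul_sum,
      ← Finset.mul_sum, ih, hcount, Finset.sum_range_succ]
    ring

set_option maxHeartbeats 1000000 in
theorem zz_core (p : ℕ) (hp : p.Prime) (n : ℕ) [NeZero (p ^ n)] (m : ℕ) (hm : m < n)
    (e : AddChar (ZMod (p ^ n)) ℂ) (he : e.IsPrimitive)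
    (f : ZMod (p ^ n) × ZMod (p ^ n) → ℂ) (a₁ a₂ : ℂ) (f0 : f 0 = 0)
    (hinv : ∀ (u : (ZMod (p ^ n))ˣ) (x : ZMod (p ^ n) × ZMod (p ^ n)),
      f ((u : ZMod (p ^ n)) • x) = f x)
    (hN0 : (∑ y, if (p : ZMod (p ^ n)) • y = 0 then f y else 0) = (p - 1) * a₁)
    (hN : ∀ x : ZMod (p ^ n) × ZMod (p ^ n), (p : ZMod (p ^ n)) ∣ x.1 → (p : ZMod (p ^ n)) ∣ x.2 →
      x ≠ 0 → (∑ y, if (p : ZMod (p ^ n)) • y = x then f y else 0) = p * (a₂ + f x)) :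
    ∑ x : ZMod (p ^ n) × ZMod (p ^ n), f x * e ((p : ZMod (p ^ n)) ^ m * x.1) =
      (p : ℂ) ^ n * f (0, (p : ZMod (p ^ n)) ^ m) -
        (a₁ + a₂ * ∑ i ∈ Finset.range (n - 1), (p : ℂ) ^ (i + 1)) := by
  set P : ZMod (p ^ n) := (p : ZMod (p ^ n)) with hP
  have hn : 1 ≤ n := by omega
  set T := ∑ x : ZMod (p ^ n) × ZMod (p ^ n), f x * e (P ^ m * x.1) with hT
  set U : ℂ := ∑ u : (ZMod (p ^ n))ˣ, (1 : ℂ) with hU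
  set A := ∑ x : ZMod (p ^ n) × ZMod (p ^ n), (if P ^ m * x.1 = 0 then 1 else 0) * f x with hA
  set B := ∑ x : ZMod (p ^ n) × ZMod (p ^ n), (if P ^ m * (P • x).1 = 0 then 1 else 0) * f x with hB
  set E := ∑ s : ZMod (p ^ n), if P ^ m * s = 0 then f (s, 1) else 0 with hE
  set D := ∑ x : ZMod (p ^ n) × ZMod (p ^ n),
    (if P ^ m * x.1 = 0 then if P ∣ x.2 then 1 else 0 else 0) * f x with hD
  -- Step 1
  have s1 : (p : ℂ) * (U * T) = (p : ℂ) ^ n * (p * A - B) := by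
    have h1 : ∀ u : (ZMod (p ^ n))ˣ, T = ∑ x : ZMod (p ^ n) × ZMod (p ^ n), f x * e (u * (P ^ m * x.1)) := by
      intro u
      rw [hT, ← Equiv.sum_comp (MulAction.toPerm u : Equiv.Perm (ZMod (p ^ n) × ZMod (p ^ n)))]
      refine Finset.sum_congr rfl fun x _ => ?_
      have : (MulAction.toPerm u : Equiv.Perm (ZMod (p ^ n) × ZMod (p ^ n))) x = (u : ZMod (p ^ n)) • x := rfl
      rw [this, hinv]
      congr 2
      simp only [Prod.smul_fst, smul_eq_mul]; ring
    rw [hU, Finset.sum_mul, Finset.sum_congr rfl fun u _ => by rw [one_mul, h1 u], Finset.sum_comm,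
      Finset.mul_sum, hA, hB, Finset.mul_sum, ← Finset.sum_sub_distrib, Finset.mul_sum]
    refine Finset.sum_congr rfl fun x _ => ?_
    rw [← Finset.mul_sum, mul_left_comm, zz_ram p hp n hn e he]
    have : (p : ZMod (p ^ n)) * (P ^ m * x.1) = P ^ m * (P • x).1 := by
      simp only [Prod.smul_fst, smul_eq_mul, hP]; ring
    rw [this]
    ring
  have s0 : (p : ℂ) * U = (p : ℂ) ^ n * (p - 1) := by
    have := zz_ram p hp n hn e he 0
    simpa [hU] using this
  -- Step 2
  have hcnt : (∑ x : ZMod (p ^ n) × ZMod (p ^ n),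
      (if P ^ m * x.1 = 0 then if P ∣ x.2 then (1 : ℂ) else 0 else 0)) = (p : ℂ) ^ m * (p : ℂ) ^ (n - 1) := by
    have e1 := zz_count0 p hp n m hm.le
    have e2 := zz_count0 p hp n (n - 1) (by omega)
    rw [← e1, ← e2, Finset.sum_mul_sum, Fintype.sum_prod_type]
    refine Finset.sum_congr rfl fun s _ => Finset.sum_congr rfl fun t _ => ?_
    have h := zz_pow_mul_eq_zero_iff p hp n (n - 1) (by omega) t
    rw [show n - (n - 1) = 1 by omega, pow_one] at h
    simp only [← hP] at h ⊢
    by_cases h1 : P ^ m * s = 0 <;> by_cases h2 : P ∣ t <;> simp [h, h1, h2]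
  have s2 : B = (p - 1) * a₁ + p * a₂ * ((p : ℂ) ^ m * (p : ℂ) ^ (n - 1) - 1) + p * D := by
    have h1 := zz_fiber (fun y : ZMod (p ^ n) × ZMod (p ^ n) => P • y)
      (fun z => if P ^ m * z.1 = 0 then 1 else 0) f
    rw [hB, h1]
    have h3 : ∀ z : ZMod (p ^ n) × ZMod (p ^ n),
        (if P ^ m * z.1 = 0 then (1 : ℂ) else 0) * (∑ y, if P • y = z then f y else 0) =
        (if z = 0 then (p - 1) * a₁ - p * a₂ else 0) +
        p * a₂ * (if P ^ m * z.1 = 0 then if P ∣ z.2 then (1 : ℂ) else 0 else 0) +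
        p * ((if P ^ m * z.1 = 0 then if P ∣ z.2 then (1 : ℂ) else 0 else 0) * f z) := by
      intro z
      by_cases hz : z = 0
      · subst hz
        rw [hN0, f0]; simp
      rw [if_neg hz]
      by_cases h1 : P ^ m * z.1 = 0
      · have hd := zz_dvd_of p hp n m hm _ h1
        by_cases h2 : P ∣ z.2
        · rw [hN z hd h2 hz]; simp [h1, h2]; ring
        · simp only [h1, h2, if_true, if_false]
          rw [Finset.sum_eq_zero]
          · simp
          intro y _
          rw [if_neg]
          rintro rfl
          exact h2 ⟨y.2, rfl⟩
      · simp [h1]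
    rw [Finset.sum_congr rfl fun z _ => h3 z, Finset.sum_add_distrib, Finset.sum_add_distrib,
      ← Finset.mul_sum, ← Finset.mul_sum, hcnt, Finset.sum_ite_eq']
    simp only [Finset.mem_univ, if_true]
    ring
  -- Step 3
  have hEt : ∀ t : ZMod (p ^ n), IsUnit t → (∑ s : ZMod (p ^ n), if P ^ m * s = 0 then f (s, t) else 0) = E := by
    rintro t ⟨u, rfl⟩
    rw [hE, ← Equiv.sum_comp (MulAction.toPerm u : Equiv.Perm (ZMod (p ^ n)))]
    refine Finset.sum_congr rfl fun s _ => ?_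
    have h1 : (MulAction.toPerm u : Equiv.Perm (ZMod (p ^ n))) s = u * s := rfl
    have h2 := hinv u (s, 1)
    rw [Prod.smul_mk, smul_eq_mul, smul_eq_mul, mul_one] at h2
    rw [h1, h2]
    have h3 : P ^ m * (u * s) = 0 ↔ P ^ m * s = 0 := by
      rw [mul_left_comm]; exact u.mul_right_eq_zero
    simp only [h3]
  have s3 : A = D + U * E := by
    rw [hU, zz_units_sum p n (fun _ => 1), Finset.sum_mul, hA, hD, ← sub_eq_iff_eq_add', ← Finset.sum_sub_distrib,
      Fintype.sum_prod_type_right]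
    refine Finset.sum_congr rfl fun t _ => ?_
    by_cases ht : IsUnit t
    · have h := (zz_isUnit_iff p hp n hn t).1 ht
      rw [if_pos ht, one_mul, ← hEt t ht]
      refine Finset.sum_congr rfl fun s _ => ?_
      simp [hP, h]
    · have h := (zz_isUnit_iff p hp n hn t).not_left.1 ht
      rw [if_neg ht, zero_mul]
      refine Finset.sum_eq_zero fun s _ => ?_
      simp [hP, h]
  -- Step 4
  have hp0 : (p : ℂ) ≠ 0 := by exact_mod_cast hp.ne_zero
  have s4 : E = f (0, P ^ m) + a₂ * ∑ i ∈ Finset.range m, (p : ℂ) ^ i := by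
    have h1 := zz_iter p hp n m hm f a₂ hN m le_rfl
    have h2 : (∑ y : ZMod (p ^ n) × ZMod (p ^ n), if P ^ m • y = (0, P ^ m) then f y else 0) = (p : ℂ) ^ m * E := by
      have e2 := zz_count p hp n m hm.le 1
      rw [← e2, Finset.sum_mul, Fintype.sum_prod_type_right]
      refine Finset.sum_congr rfl fun t _ => ?_
      by_cases ht : P ^ m * t = P ^ m * 1
      · have htu : IsUnit t := by
          rw [zz_isUnit_iff p hp n hn]
          intro hd
          have h3 := zz_dvd_of p hp n m hm (t - 1) (by rw [mul_sub, ← hP, ht, sub_self])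
          have h4 := dvd_sub hd h3
          rw [sub_sub_cancel] at h4
          exact (zz_isUnit_iff p hp n hn 1).1 isUnit_one h4
        rw [if_pos ht, one_mul, ← hEt t htu]
        refine Finset.sum_congr rfl fun s _ => ?_
        rw [mul_one] at ht
        simp [ht]
      · rw [if_neg ht, zero_mul]
        refine Finset.sum_eq_zero fun s _ => ?_
        rw [mul_one] at ht
        simp [ht]
    rw [h2] at h1
    exact mul_left_cancel₀ (pow_ne_zero _ hp0) h1
  -- Final
  have hp1 : (p : ℂ) - 1 ≠ 0 := by
    rw [sub_ne_zero]; exact_mod_cast hp.one_lt.ne'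
  have g1 : (∑ i ∈ Finset.range m, (p : ℂ) ^ i) * (p - 1) = (p : ℂ) ^ m - 1 := geom_sum_mul _ _
  have g2 : (∑ i ∈ Finset.range (n - 1), (p : ℂ) ^ (i + 1)) * (p - 1) = (p : ℂ) ^ n - p := by
    have := geom_sum_mul (p : ℂ) (n - 1)
    simp_rw [pow_succ]
    rw [← Finset.sum_mul, mul_right_comm, this, sub_mul, ← pow_succ, Nat.sub_add_cancel hn, one_mul]
  have hpn : (p : ℂ) ^ n = p * (p : ℂ) ^ (n - 1) := by
    rw [← pow_succ', Nat.sub_add_cancel hn]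
  have hpn0 : (p : ℂ) ^ n ≠ 0 := pow_ne_zero _ hp0
  apply mul_left_cancel₀ hpn0
  apply mul_left_cancel₀ hp1
  apply mul_left_cancel₀ hp1
  have k1 : (p : ℂ) ^ n * ((p - 1) * T) = (p : ℂ) ^ n * (p * A - B) := by
    rw [← s1]; linear_combination (-T) * s0
  have k2 := mul_left_cancel₀ hpn0 k1
  rw [s2, s3] at k2
  have k3 : ((p : ℂ) - 1) * T = (p : ℂ) ^ n * (p - 1) * E - ((p - 1) * a₁ + a₂ * ((p : ℂ) ^ m * (p : ℂ) ^ n - p)) := by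
    rw [k2, hpn]
    rw [hpn] at s0
    linear_combination E * s0
  have k4 : ((p : ℂ) - 1) * E = (p - 1) * f (0, P ^ m) + a₂ * ((p : ℂ) ^ m - 1) := by
    rw [s4]; linear_combination a₂ * g1
  linear_combination ((p : ℂ) ^ n * (p - 1)) * k3 + ((p : ℂ) ^ n * (p - 1) * (p : ℂ) ^ n) * k4 - (p : ℂ) ^ n * (p - 1) * (-a₂) * g2

theorem zz_gens {G : Type*} [AddCommGroup G] [Fintype G] (x : G) :
    Nat.card {y : G // AddSubgroup.zmultiples y = AddSubgroup.zmultiples x} =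
      Nat.totient (addOrderOf x) := by
  classical
  have h := IsAddCyclic.card_addOrderOf_eq_totient (α := AddSubgroup.zmultiples x)
    (d := addOrderOf x) (by rw [Fintype.card_zmultiples])
  rw [← h, ← Nat.card_eq_finsetCard]
  refine (Nat.card_congr (Equiv.ofBijective
    (fun z : {z // z ∈ Finset.filter (fun z : AddSubgroup.zmultiples x => addOrderOf z = addOrderOf x) Finset.univ} =>
      (⟨z.1.1, ?_⟩ : {y : G // AddSubgroup.zmultiples y = AddSubgroup.zmultiples x})) ⟨?_, ?_⟩)).symm
  · have h1 := (Finset.mem_filter.1 z.2).2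
    have h2 : AddSubgroup.zmultiples (z.1.1) ≤ AddSubgroup.zmultiples x := by
      rw [AddSubgroup.zmultiples_le]; exact z.1.2
    refine AddSubgroup.eq_of_le_of_card_ge h2 ?_
    rw [Nat.card_zmultiples, Nat.card_zmultiples, AddSubgroup.addOrderOf_coe]
    exact h1.ge
  · intro z w hzw
    exact Subtype.ext (Subtype.ext (congrArg (fun t => t.1) hzw))
  · rintro ⟨y, hy⟩
    have hm : y ∈ AddSubgroup.zmultiples x := hy ▸ AddSubgroup.mem_zmultiples y
    refine ⟨⟨⟨y, hm⟩, ?_⟩, rfl⟩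
    rw [Finset.mem_filter]
    refine ⟨Finset.mem_univ _, ?_⟩
    rw [AddSubgroup.addOrderOf_mk, ← Nat.card_zmultiples, hy, Nat.card_zmultiples]

theorem zz_smul_mem (N : ℕ) [NeZero N] (r : ZMod N) (x : ZMod N × ZMod N) :
    r • x ∈ AddSubgroup.zmultiples x := by
  have : r • x = r.val • x := by
    rw [← Nat.cast_smul_eq_nsmul (ZMod N), ZMod.natCast_zmod_val]
  rw [this]
  exact AddSubgroup.nsmul_mem_zmultiples _ _

theorem zz_zmul_unit (N : ℕ) [NeZero N] (u : (ZMod N)ˣ) (x : ZMod N × ZMod N) :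
    AddSubgroup.zmultiples ((u : ZMod N) • x) = AddSubgroup.zmultiples x := by
  apply le_antisymm
  · rw [AddSubgroup.zmultiples_le]; exact zz_smul_mem N _ _
  · rw [AddSubgroup.zmultiples_le]
    have := zz_smul_mem N ((u⁻¹ : (ZMod N)ˣ) : ZMod N) ((u : ZMod N) • x)
    rwa [smul_smul, Units.inv_mul, one_smul] at this

theorem zz_unit_of (p : ℕ) (hp : p.Prime) (n : ℕ) (hn : 1 ≤ n) [NeZero (p ^ n)]
    (x y : ZMod (p ^ n) × ZMod (p ^ n))
    (h : AddSubgroup.zmultiples y = AddSubgroup.zmultiples x) :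
    ∃ u : (ZMod (p ^ n))ˣ, y = (u : ZMod (p ^ n)) • x := by
  have h1 : y ∈ AddSubgroup.zmultiples x := h ▸ AddSubgroup.mem_zmultiples y
  have h2 : x ∈ AddSubgroup.zmultiples y := h.symm ▸ AddSubgroup.mem_zmultiples x
  obtain ⟨k, hk⟩ := AddSubgroup.mem_zmultiples_iff.1 h1
  obtain ⟨l, hl⟩ := AddSubgroup.mem_zmultiples_iff.1 h2
  rw [← Int.cast_smul_eq_zsmul (ZMod (p ^ n))] at hk hl
  by_cases hu : IsUnit (k : ZMod (p ^ n))
  · obtain ⟨u, hu⟩ := hu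
    exact ⟨u, by rw [hu, hk]⟩
  · rw [zz_isUnit_iff p hp n hn, not_not] at hu
    have h3 : IsUnit (1 - (l : ZMod (p ^ n)) * k) := by
      rw [zz_isUnit_iff p hp n hn]
      intro hd
      have := dvd_add hd (Dvd.dvd.mul_left hu (l : ZMod (p ^ n)))
      rw [sub_add_cancel] at this
      exact (zz_isUnit_iff p hp n hn 1).1 isUnit_one this
    have h4 : (1 - (l : ZMod (p ^ n)) * k) • x = 0 := by
      rw [sub_smul, one_smul, mul_smul, hk, hl, sub_self]
    have h5 : x = 0 := (h3.smul_eq_zero).1 h4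
    refine ⟨1, ?_⟩
    rw [← hk, h5, smul_zero, smul_zero]

theorem zz_N1 (p : ℕ) (hp : p.Prime) (n : ℕ) (hn : 1 ≤ n) [NeZero (p ^ n)]
    (S : Set (AddSubgroup (ZMod (p ^ n) × ZMod (p ^ n)))) (hbot : ⊥ ∉ S)
    (f : ZMod (p ^ n) × ZMod (p ^ n) → ℂ)
    (hf1 : ∀ g, AddSubgroup.zmultiples g ∈ S → f g = 1)
    (hf0 : ∀ g, AddSubgroup.zmultiples g ∉ S → f g = 0)
    (x : ZMod (p ^ n) × ZMod (p ^ n)) :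
    (Nat.totient (addOrderOf x) : ℂ) * (∑ y, if (p : ZMod (p ^ n)) • y = x then f y else 0) =
      (Nat.card {F : AddSubgroup (ZMod (p ^ n) × ZMod (p ^ n)) //
        IsCyc p n F ∧ father p n F = AddSubgroup.zmultiples x ∧ F ∈ S} : ℂ) *
        (Nat.totient (p * addOrderOf x) : ℂ) := by
  classical
  have : Fintype (AddSubgroup (ZMod (p ^ n) × ZMod (p ^ n))) := Fintype.ofFinite _
  have hfather : ∀ y : ZMod (p ^ n) × ZMod (p ^ n), father p n (AddSubgroup.zmultiples y) =
      AddSubgroup.zmultiples ((p : ZMod (p ^ n)) • y) := by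
    intro y
    unfold father
    rw [AddMonoidHom.map_zmultiples, Nat.cast_smul_eq_nsmul]
    rfl
  have hcard : ∀ x : ZMod (p ^ n) × ZMod (p ^ n),
      (∑ y, if AddSubgroup.zmultiples y = AddSubgroup.zmultiples x then (1 : ℂ) else 0) =
        (Nat.totient (addOrderOf x) : ℂ) := by
    intro x
    rw [← zz_gens x, Nat.card_eq_fintype_card, Fintype.card_subtype, Finset.sum_boole]
  have hfinv : ∀ (u : (ZMod (p ^ n))ˣ) (y : ZMod (p ^ n) × ZMod (p ^ n)),
      f ((u : ZMod (p ^ n)) • y) = f y := by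
    intro u y
    by_cases hy : AddSubgroup.zmultiples y ∈ S
    · rw [hf1 _ hy, hf1]; rwa [zz_zmul_unit]
    · rw [hf0 _ hy, hf0]; rwa [zz_zmul_unit]
  have c1 : ∑ y, (if AddSubgroup.zmultiples ((p : ZMod (p ^ n)) • y) = AddSubgroup.zmultiples x then 1 else 0) * f y
      = (Nat.totient (addOrderOf x) : ℂ) * (∑ y, if (p : ZMod (p ^ n)) • y = x then f y else 0) := by
    rw [zz_fiber (fun y : ZMod (p ^ n) × ZMod (p ^ n) => (p : ZMod (p ^ n)) • y)
      (fun z => if AddSubgroup.zmultiples z = AddSubgroup.zmultiples x then 1 else 0) f, ← hcard,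
      Finset.sum_mul]
    refine Finset.sum_congr rfl fun x' _ => ?_
    by_cases hx : AddSubgroup.zmultiples x' = AddSubgroup.zmultiples x
    · rw [if_pos hx]
      congr 1
      obtain ⟨u, rfl⟩ := zz_unit_of p hp n hn x x' hx
      rw [← Equiv.sum_comp (MulAction.toPerm u : Equiv.Perm (ZMod (p ^ n) × ZMod (p ^ n)))]
      refine Finset.sum_congr rfl fun y _ => ?_
      have h1 : (MulAction.toPerm u : Equiv.Perm (ZMod (p ^ n) × ZMod (p ^ n))) y = (u : ZMod (p ^ n)) • y := rfl
      rw [h1, hfinv, smul_comm]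
      have h2 : (u : ZMod (p ^ n)) • (p : ZMod (p ^ n)) • y = (u : ZMod (p ^ n)) • x ↔
          (p : ZMod (p ^ n)) • y = x := u.isUnit.smul_left_cancel
      simp only [h2]
    · rw [if_neg hx, zero_mul, zero_mul]
  rw [← c1]
  have c2 : ∀ y, (if AddSubgroup.zmultiples ((p : ZMod (p ^ n)) • y) = AddSubgroup.zmultiples x then 1 else 0) * f y
      = ∑ F : AddSubgroup (ZMod (p ^ n) × ZMod (p ^ n)),
        (if IsCyc p n F ∧ father p n F = AddSubgroup.zmultiples x ∧ F ∈ S then 1 else 0) *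
          (if AddSubgroup.zmultiples y = F then (1 : ℂ) else 0) := by
    intro y
    simp only [mul_ite, mul_one, mul_zero, Finset.sum_ite_eq, Finset.mem_univ, if_true]
    rw [hfather]
    have hc : IsCyc p n (AddSubgroup.zmultiples y) := ⟨y, rfl⟩
    by_cases hy : AddSubgroup.zmultiples y ∈ S
    · rw [hf1 _ hy]; simp [hy, hc]
    · rw [hf0 _ hy]; simp [hy]
  rw [Finset.sum_congr rfl fun y _ => c2 y, Finset.sum_comm, Nat.card_eq_fintype_card,
    Fintype.card_subtype, ← Finset.sum_boole, Finset.sum_mul]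
  refine Finset.sum_congr rfl fun F _ => ?_
  rw [← Finset.mul_sum]
  by_cases hF : IsCyc p n F ∧ father p n F = AddSubgroup.zmultiples x ∧ F ∈ S
  · rw [if_pos hF]
    congr 1
    obtain ⟨⟨y, rfl⟩, h2, h3⟩ := hF
    rw [hcard y]
    congr 2
    rw [hfather] at h2
    have h4 : addOrderOf x = addOrderOf (p • y) := by
      rw [← Nat.card_zmultiples, ← Nat.card_zmultiples, ← h2, Nat.cast_smul_eq_nsmul]
    have h5 : addOrderOf y ∣ p ^ n := by
      apply addOrderOf_dvd_of_nsmul_eq_zero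
      rw [← Nat.cast_smul_eq_nsmul (ZMod (p ^ n)), ZMod.natCast_self, zero_smul]
    have h6 : p ∣ addOrderOf y := by
      obtain ⟨k, hk, hk2⟩ := (Nat.dvd_prime_pow hp).1 h5
      rw [hk2]
      apply dvd_pow_self
      rintro rfl
      rw [pow_zero, AddMonoid.addOrderOf_eq_one_iff] at hk2
      rw [hk2, AddSubgroup.zmultiples_zero_eq_bot] at h3
      exact hbot h3
    rw [h4, addOrderOf_nsmul, Nat.gcd_eq_right h6, Nat.mul_div_cancel' h6]
  · rw [if_neg hF, zero_mul, zero_mul]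

theorem zz_decomp (p : ℕ) (hp : p.Prime) (n : ℕ) (hn : 1 ≤ n) [NeZero (p ^ n)]
    (χ : AddChar (ZMod (p ^ n) × ZMod (p ^ n)) ℂ) (hχ : ∃ g, χ g ≠ 1) :
    ∃ m < n, ∃ Φ : (ZMod (p ^ n) × ZMod (p ^ n)) ≃ₗ[ZMod (p ^ n)] (ZMod (p ^ n) × ZMod (p ^ n)),
      ∀ x, χ (Φ x) = ZMod.stdAddChar ((p : ZMod (p ^ n)) ^ m * x.1) := by
  classical
  obtain ⟨α, hα⟩ := zz_char p n (χ.compAddMonoidHom (AddMonoidHom.inl _ _))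
  obtain ⟨β, hβ⟩ := zz_char p n (χ.compAddMonoidHom (AddMonoidHom.inr _ _))
  have hχ' : ∀ x, χ x = ZMod.stdAddChar (α * x.1 + β * x.2) := by
    intro x
    rw [AddChar.map_add_eq_mul, ← hα, ← hβ, AddChar.compAddMonoidHom_apply,
      AddChar.compAddMonoidHom_apply, ← AddChar.map_add_eq_mul]
    simp
  have hne : ¬ (α = 0 ∧ β = 0) := by
    rintro ⟨rfl, rfl⟩
    obtain ⟨g, hg⟩ := hχ
    rw [hχ'] at hg
    simp at hg
  have hex : ∃ j, ¬ ((p : ZMod (p ^ n)) ^ j ∣ α ∧ (p : ZMod (p ^ n)) ^ j ∣ β) := by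
    refine ⟨n, ?_⟩
    rw [← Nat.cast_pow, ZMod.natCast_self, zero_dvd_iff, zero_dvd_iff]
    exact hne
  have hle : Nat.find hex ≤ n := by
    apply Nat.find_min'
    rw [← Nat.cast_pow, ZMod.natCast_self, zero_dvd_iff, zero_dvd_iff]
    exact hne
  have hpos : Nat.find hex ≠ 0 := by
    intro h
    have := Nat.find_spec hex
    rw [h] at this
    simp at this
  obtain ⟨m, hm⟩ := Nat.exists_eq_succ_of_ne_zero hpos
  have hspec := Nat.find_spec hex
  have hmin := not_not.1 (Nat.find_min hex (m := m) (by omega))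
  rw [hm] at hspec
  obtain ⟨⟨α', rfl⟩, ⟨β', rfl⟩⟩ := hmin
  refine ⟨m, by omega, ?_⟩
  have hu : IsUnit α' ∨ IsUnit β' := by
    rw [zz_isUnit_iff p hp n hn, zz_isUnit_iff p hp n hn]
    by_contra hcon
    push Not at hcon
    apply hspec
    rw [Nat.succ_eq_add_one, pow_succ]
    exact ⟨mul_dvd_mul_left _ hcon.1, mul_dvd_mul_left _ hcon.2⟩
  rcases hu with ⟨u, rfl⟩ | ⟨u, rfl⟩
  · refine ⟨{ toFun := fun x => ((u⁻¹ : (ZMod (p ^ n))ˣ) * (x.1 - β' * x.2), x.2)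
              invFun := fun x => (u * x.1 + β' * x.2, x.2)
              map_add' := ?_, map_smul' := ?_, left_inv := ?_, right_inv := ?_ }, ?_⟩
    · intro x y; ext <;> simp; ring
    · intro r x; ext <;> simp; ring
    · intro x; ext <;> simp
    · intro x; ext <;> simp
    · intro x
      rw [hχ']
      congr 1
      show (p : ZMod (p ^ n)) ^ m * u * ((u⁻¹ : (ZMod (p ^ n))ˣ) * (x.1 - β' * x.2)) + _ * x.2 = _
      have := u.mul_inv
      linear_combination (p : ZMod (p ^ n)) ^ m * (x.1 - β' * x.2) * this
  · refine ⟨{ toFun := fun x => (x.2, (u⁻¹ : (ZMod (p ^ n))ˣ) * (x.1 - α' * x.2))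
              invFun := fun x => (α' * x.1 + u * x.2, x.1)
              map_add' := ?_, map_smul' := ?_, left_inv := ?_, right_inv := ?_ }, ?_⟩
    · intro x y; ext <;> simp; ring
    · intro r x; ext <;> simp; ring
    · intro x; ext <;> simp
    · intro x; ext <;> simp
    · intro x
      rw [hχ']
      congr 1
      show _ * x.2 + (p : ZMod (p ^ n)) ^ m * u * ((u⁻¹ : (ZMod (p ^ n))ˣ) * (x.1 - α' * x.2)) = _
      have := u.mul_inv
      linear_combination (p : ZMod (p ^ n)) ^ m * (x.1 - α' * x.2) * this

theorem zz_delta (p : ℕ) (hp : p.Prime) (n : ℕ) [NeZero (p ^ n)]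
    (H : AddSubgroup (ZMod (p ^ n) × ZMod (p ^ n))) (m : ℕ) (hm : m < n)
    (Φ : (ZMod (p ^ n) × ZMod (p ^ n)) ≃ₗ[ZMod (p ^ n)] (ZMod (p ^ n) × ZMod (p ^ n)))
    (hH : ∀ x, Φ x ∈ H ↔ (p : ZMod (p ^ n)) ^ m * x.1 = 0) :
    deltaMap p n H = AddSubgroup.zmultiples (Φ (0, (p : ZMod (p ^ n)) ^ m)) := by
  classical
  have hcard : Nat.card H = p ^ (n + m) := by
    have h1 : Nat.card H = Nat.card {x : ZMod (p ^ n) × ZMod (p ^ n) // (p : ZMod (p ^ n)) ^ m * x.1 = 0} :=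
      (Nat.card_congr (Equiv.subtypeEquiv Φ.toEquiv fun x => (hH x).symm)).symm
    have h2 : ((Nat.card {x : ZMod (p ^ n) × ZMod (p ^ n) // (p : ZMod (p ^ n)) ^ m * x.1 = 0} : ℕ) : ℂ)
        = (p : ℂ) ^ (n + m) := by
      rw [Nat.card_eq_fintype_card, Fintype.card_subtype, ← Finset.sum_boole, Fintype.sum_prod_type_right]
      simp only [zz_count0 p hp n m hm.le]
      simp [ZMod.card, pow_add]
    rw [h1]; exact_mod_cast h2
  have hlen : len p n H = n + m := by
    unfold len
    rw [hcard, hp.factorization_pow]; simp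
  unfold deltaMap
  rw [hlen, Nat.add_sub_cancel_left]
  have hpP : ∀ g, pPow p n m g = (p : ZMod (p ^ n)) ^ m • g := by
    intro g
    rw [← Nat.cast_pow, Nat.cast_smul_eq_nsmul]; rfl
  ext g
  rw [AddSubgroup.mem_map]
  constructor
  · rintro ⟨h, hh, rfl⟩
    obtain ⟨x, rfl⟩ := Φ.surjective h
    have h0 := (hH x).1 hh
    rw [hpP, ← map_smul]
    have : (p : ZMod (p ^ n)) ^ m • x = x.2 • ((0 : ZMod (p ^ n)), (p : ZMod (p ^ n)) ^ m) := by
      ext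
      · simp [h0]
      · simp [mul_comm]
    rw [this, map_smul]
    exact zz_smul_mem _ _ _
  · intro hg
    obtain ⟨k, rfl⟩ := AddSubgroup.mem_zmultiples_iff.1 hg
    refine ⟨k • Φ (0, 1), H.zsmul_mem ((hH _).2 (by simp)) _, ?_⟩
    rw [map_zsmul, hpP, ← map_smul]
    simp

theorem zz_finsum (p n : ℕ) [NeZero (p ^ n)]
    (S : Set (AddSubgroup (ZMod (p ^ n) × ZMod (p ^ n))))
    (f : ZMod (p ^ n) × ZMod (p ^ n) → ℂ)
    (hf1 : ∀ g, AddSubgroup.zmultiples g ∈ S → f g = 1)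
    (hf0 : ∀ g, AddSubgroup.zmultiples g ∉ S → f g = 0)
    (χ : ZMod (p ^ n) × ZMod (p ^ n) → ℂ) :
    ∑ᶠ F ∈ S, ∑ᶠ g ∈ {g | AddSubgroup.zmultiples g = F}, χ g = ∑ g, f g * χ g := by
  classical
  have : Fintype (AddSubgroup (ZMod (p ^ n) × ZMod (p ^ n))) := Fintype.ofFinite _
  simp only [finsum_eq_sum_of_fintype, finsum_eq_if, Set.mem_ofPred_eq]
  have : ∀ F : AddSubgroup (ZMod (p ^ n) × ZMod (p ^ n)),
      (if F ∈ S then ∑ g, (if AddSubgroup.zmultiples g = F then χ g else 0) else 0) =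
      ∑ g, if AddSubgroup.zmultiples g = F then (if F ∈ S then χ g else 0) else 0 := by
    intro F
    split_ifs <;> simp
  simp only [this]
  rw [Finset.sum_comm]
  refine Finset.sum_congr rfl fun g _ => ?_
  rw [Finset.sum_ite_eq]
  by_cases hg : AddSubgroup.zmultiples g ∈ S
  · simp [hg, hf1 g hg]
  · simp [hg, hf0 g hg]

/-- let `S ⊆ Δ` be an `(a₁, a₂, ..., a₂)`-homogeneous set (constant tail).
For every non-principal irreducible character `χ` of `G = ℤ_{pⁿ} ⊕ ℤ_{pⁿ}` with kernel
`H`, the value of `χ` on `[S] = ∑_{F ∈ S} O_F` equals `-∑_{i=1}^n aᵢ p^{i-1} + δ·pⁿ`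
with `δ = [H^Δ ∈ S]`; in particular `[S]` takes exactly the two values `s` and `s + pⁿ`
on non-principal characters, where `s = -a₁ - a₂(pⁿ - p)/(p - 1)`. -/
theorem stmt_16 (p : ℕ) (hp : p.Prime) (n : ℕ) (hn : 1 ≤ n) [NeZero (p ^ n)]
    (a : ℕ → ℕ) (ha1 : a 1 ≤ p + 1) (ham : ∀ i, 2 ≤ i → i ≤ n → a i ≤ p - 1)
    (hconst : ∀ i, 2 ≤ i → i ≤ n → a i = a 2)
    (S : Set (AddSubgroup (ZMod (p ^ n) × ZMod (p ^ n))))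
    (hScyc : ∀ F ∈ S, IsCyc p n F) (hS : IsHomog p n S a)
    (χ : AddChar (ZMod (p ^ n) × ZMod (p ^ n)) ℂ) (hχ : ∃ g, χ g ≠ 1)
    (H : AddSubgroup (ZMod (p ^ n) × ZMod (p ^ n))) (hker : ∀ g, χ g = 1 ↔ g ∈ H) :
    ((deltaMap p n H ∈ S →
      ∑ᶠ F ∈ S, ∑ᶠ g ∈ {g | AddSubgroup.zmultiples g = F}, χ g =
        -(∑ i ∈ Finset.Icc 1 n, (a i : ℂ) * (p : ℂ) ^ (i - 1)) + (p : ℂ) ^ n) ∧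
    (deltaMap p n H ∉ S →
      ∑ᶠ F ∈ S, ∑ᶠ g ∈ {g | AddSubgroup.zmultiples g = F}, χ g =
        -(∑ i ∈ Finset.Icc 1 n, (a i : ℂ) * (p : ℂ) ^ (i - 1)))) ∧
    (∑ᶠ F ∈ S, ∑ᶠ g ∈ {g | AddSubgroup.zmultiples g = F}, χ g =
        ((-(a 1 : ℤ) - (a 2 : ℤ) * (((p : ℤ) ^ n - p) / ((p : ℤ) - 1)) : ℤ) : ℂ) ∨
     ∑ᶠ F ∈ S, ∑ᶠ g ∈ {g | AddSubgroup.zmultiples g = F}, χ g =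
        ((-(a 1 : ℤ) - (a 2 : ℤ) * (((p : ℤ) ^ n - p) / ((p : ℤ) - 1)) : ℤ) : ℂ)
          + (p : ℂ) ^ n) := by
  classical
  obtain ⟨hbot, hhom⟩ := hS
  obtain ⟨f, hf1, hf0⟩ : ∃ f : ZMod (p ^ n) × ZMod (p ^ n) → ℂ,
      (∀ g, AddSubgroup.zmultiples g ∈ S → f g = 1) ∧
      (∀ g, AddSubgroup.zmultiples g ∉ S → f g = 0) :=
    ⟨fun g => if AddSubgroup.zmultiples g ∈ S then 1 else 0,
      fun g hg => if_pos hg, fun g hg => if_neg hg⟩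
  rw [zz_finsum p n S f hf1 hf0 χ]
  have hp0 : (p : ℂ) ≠ 0 := by exact_mod_cast hp.ne_zero
  have hinv : ∀ (u : (ZMod (p ^ n))ˣ) (y : ZMod (p ^ n) × ZMod (p ^ n)),
      f ((u : ZMod (p ^ n)) • y) = f y := by
    intro u y
    by_cases hy : AddSubgroup.zmultiples y ∈ S
    · rw [hf1 _ hy, hf1]; rwa [zz_zmul_unit]
    · rw [hf0 _ hy, hf0]; rwa [zz_zmul_unit]
  have f0 : f 0 = 0 := hf0 0 (by rwa [AddSubgroup.zmultiples_zero_eq_bot])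
  have hN0 : (∑ y, if (p : ZMod (p ^ n)) • y = 0 then f y else 0) = (p - 1) * (a 1 : ℂ) := by
    have h1 := zz_N1 p hp n hn S hbot f hf1 hf0 0
    have hl : len p n (AddSubgroup.zmultiples 0) = 0 := by
      unfold len
      rw [Nat.card_zmultiples]; simp
    have h2 := (hhom (AddSubgroup.zmultiples 0) ⟨0, rfl⟩ (by omega)).2
      (by rwa [AddSubgroup.zmultiples_zero_eq_bot])
    rw [h2, hl] at h1
    simp only [addOrderOf_zero, Nat.totient_one, Nat.cast_one, one_mul, mul_one, zero_add,
      Nat.totient_prime hp] at h1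
    rw [h1, Nat.cast_sub hp.one_lt.le]
    push_cast; ring
  have hN : ∀ x' : ZMod (p ^ n) × ZMod (p ^ n), (p : ZMod (p ^ n)) • x' ≠ 0 →
      (∑ y, if (p : ZMod (p ^ n)) • y = (p : ZMod (p ^ n)) • x' then f y else 0) =
        p * ((a 2 : ℂ) + f ((p : ZMod (p ^ n)) • x')) := by
    intro x' hx
    have h1 := zz_N1 p hp n hn S hbot f hf1 hf0 ((p : ZMod (p ^ n)) • x')
    generalize hxx : (p : ZMod (p ^ n)) • x' = x at *
    have h5 : addOrderOf x ∣ p ^ (n - 1) := by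
      apply addOrderOf_dvd_of_nsmul_eq_zero
      rw [← hxx, ← Nat.cast_smul_eq_nsmul (ZMod (p ^ n)), smul_smul, Nat.cast_pow, ← pow_succ,
        Nat.sub_add_cancel hn, ← Nat.cast_pow, ZMod.natCast_self, zero_smul]
    obtain ⟨l, hl, hl2⟩ := (Nat.dvd_prime_pow hp).1 h5
    have hl0 : l ≠ 0 := by
      rintro rfl
      rw [pow_zero, AddMonoid.addOrderOf_eq_one_iff] at hl2
      exact hx hl2
    have hlen : len p n (AddSubgroup.zmultiples x) = l := by
      unfold len
      rw [Nat.card_zmultiples, hl2, hp.factorization_pow]; simp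
    have h2 := hhom (AddSubgroup.zmultiples x) ⟨x, rfl⟩ (by omega)
    rw [hlen, hconst (l + 1) (by omega) (by omega)] at h2
    have h3 : (Nat.card {F : AddSubgroup (ZMod (p ^ n) × ZMod (p ^ n)) //
        IsCyc p n F ∧ father p n F = AddSubgroup.zmultiples x ∧ F ∈ S} : ℂ) = (a 2 : ℂ) + f x := by
      by_cases hxS : AddSubgroup.zmultiples x ∈ S
      · rw [h2.1 hxS, hf1 x hxS]; push_cast; rfl
      · rw [h2.2 hxS, hf0 x hxS, add_zero]
    rw [h3, hl2, Nat.totient_mul_of_prime_of_dvd hp (dvd_pow_self p hl0)] at h1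
    have h4 : ((Nat.totient (p ^ l) : ℕ) : ℂ) ≠ 0 := by
      exact_mod_cast (Nat.totient_pos.2 (pow_pos hp.pos l)).ne'
    apply mul_left_cancel₀ h4
    rw [h1]; push_cast; ring
  obtain ⟨m, hm, Φ, hΦ⟩ := zz_decomp p hp n hn χ hχ
  have hstd := ZMod.isPrimitive_stdAddChar (p ^ n)
  have hH : ∀ x, Φ x ∈ H ↔ (p : ZMod (p ^ n)) ^ m * x.1 = 0 := by
    intro x
    rw [← hker, hΦ, hstd.zmod_char_eq_one_iff]
  have hdelta := zz_delta p hp n H m hm Φ hH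
  have htr : ∀ x, (∑ y, if (p : ZMod (p ^ n)) • y = x then f (Φ y) else 0) =
      ∑ y, if (p : ZMod (p ^ n)) • y = Φ x then f y else 0 := by
    intro x
    rw [← Equiv.sum_comp Φ.toEquiv (fun y => if (p : ZMod (p ^ n)) • y = Φ x then f y else 0)]
    refine Finset.sum_congr rfl fun y _ => ?_
    have : (p : ZMod (p ^ n)) • Φ y = Φ x ↔ (p : ZMod (p ^ n)) • y = x := by
      rw [← map_smul]; exact Φ.injective.eq_iff
    simp only [this, LinearEquiv.coe_toEquiv]
  have hcore := zz_core p hp n m hm ZMod.stdAddChar hstd (fun x => f (Φ x)) (a 1) (a 2)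
    (by rw [map_zero, f0]) (fun u x => by rw [map_smul, hinv])
    (by rw [htr, map_zero, hN0]) (by
      rintro ⟨x1, x2⟩ ⟨c1, hc1⟩ ⟨c2, hc2⟩ hx
      have he : (x1, x2) = (p : ZMod (p ^ n)) • (c1, c2) := Prod.ext hc1 hc2
      rw [he] at hx ⊢
      rw [htr, map_smul]
      apply hN
      rw [← map_smul]
      exact fun h => hx (Φ.map_eq_zero_iff.1 h))
  have hsum : ∑ g, f g * χ g = ∑ x : ZMod (p ^ n) × ZMod (p ^ n),
      f (Φ x) * ZMod.stdAddChar ((p : ZMod (p ^ n)) ^ m * x.1) := by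
    rw [← Equiv.sum_comp Φ.toEquiv]
    refine Finset.sum_congr rfl fun x _ => ?_
    rw [LinearEquiv.coe_toEquiv, hΦ]
  rw [hsum, hcore]
  have hgeo : ∑ i ∈ Finset.Icc 1 n, (a i : ℂ) * (p : ℂ) ^ (i - 1) =
      (a 1 : ℂ) + (a 2 : ℂ) * ∑ i ∈ Finset.range (n - 1), (p : ℂ) ^ (i + 1) := by
    obtain ⟨k, rfl⟩ : ∃ k, n = k + 1 := ⟨n - 1, by omega⟩
    have h1 : ∑ i ∈ Finset.Icc 1 (k + 1), (a i : ℂ) * (p : ℂ) ^ (i - 1) =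
        ∑ i ∈ Finset.range (k + 1), (a (i + 1) : ℂ) * (p : ℂ) ^ i := by
      have h := Finset.sum_Ico_add' (fun i => (a i : ℂ) * (p : ℂ) ^ (i - 1)) 0 (k + 1) 1
      simp only [Nat.add_sub_cancel] at h
      rw [Finset.range_eq_Ico, h]
      rfl
    rw [h1, Finset.sum_range_succ', Finset.mul_sum, add_comm]
    congr 1
    · simp
    · refine Finset.sum_congr rfl fun i hi => ?_
      have := Finset.mem_range.1 hi
      rw [hconst (i + 1 + 1) (by omega) (by omega)]
  have hint : ((-(a 1 : ℤ) - (a 2 : ℤ) * (((p : ℤ) ^ n - p) / ((p : ℤ) - 1)) : ℤ) : ℂ) =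
      -((a 1 : ℂ) + (a 2 : ℂ) * ∑ i ∈ Finset.range (n - 1), (p : ℂ) ^ (i + 1)) := by
    have hp1 : (p : ℤ) - 1 ≠ 0 := by
      have := hp.one_lt
      omega
    have g2 : (∑ i ∈ Finset.range (n - 1), (p : ℤ) ^ (i + 1)) * (p - 1) = (p : ℤ) ^ n - p := by
      have := geom_sum_mul (p : ℤ) (n - 1)
      simp_rw [pow_succ]
      rw [← Finset.sum_mul, mul_right_comm, this, sub_mul, ← pow_succ, Nat.sub_add_cancel hn, one_mul]
    rw [← g2, Int.mul_ediv_cancel _ hp1]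
    push_cast
    ring
  rw [hgeo, hint, hdelta]
  by_cases hd : AddSubgroup.zmultiples (Φ (0, (p : ZMod (p ^ n)) ^ m)) ∈ S
  · rw [hf1 _ hd]
    exact ⟨⟨fun _ => by ring, fun h => absurd hd h⟩, Or.inr (by ring)⟩
  · rw [hf0 _ hd]
    exact ⟨⟨fun h => absurd h hd, fun _ => by ring⟩, Or.inl (by ring)⟩
end

section
/- Let p be a prime, n ≥ 1, G = Z_{p^n} ⊕ Z_{p^n}, and let S ⊆ Δ be an (a_1,...,a_n)-homogeneous set. Then the Cayley graph on G generated by the union of the generator-sets O_F over F ∈ S is strongly regular if and only if a_2 = a_3 = ··· = a_n. -/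
section basics
open Finset

theorem cyc_card_torsion {A : Type*} [AddCommGroup A] [Fintype A] [DecidableEq A] [IsAddCyclic A]
    {d : ℕ} (hd : d ∣ Fintype.card A) : #{x : A | d • x = 0} = d := by
  have hd0 : d ≠ 0 := by
    rintro rfl
    exact Fintype.card_ne_zero (zero_dvd_iff.mp hd)
  rw [← sum_card_addOrderOf_eq_card_nsmul_eq_zero hd0]
  conv_rhs => rw [← Nat.sum_totient d]
  apply Finset.sum_congr rfl
  intro m hm
  exact IsAddCyclic.card_addOrderOf_eq_totient ((Nat.dvd_of_mem_divisors hm).trans hd)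

variable {p n : ℕ} [NeZero (p ^ n)]

theorem zmod_card_torsion {l : ℕ} (hl : l ≤ n) :
    #{j : ZMod (p ^ n) | p ^ l • j = 0} = p ^ l := by
  apply cyc_card_torsion
  rw [ZMod.card]
  exact pow_dvd_pow p hl

theorem zmod_exists_div (hp : p.Prime) {l : ℕ} (hl : l ≤ n) (z : ZMod (p ^ n))
    (hz : p ^ (n - l) • z = 0) : ∃ w, z = p ^ l • w := by
  have h1 : ((p ^ (n - l) * z.val : ℕ) : ZMod (p ^ n)) = 0 := by
    rw [Nat.cast_mul, ZMod.natCast_zmod_val, ← nsmul_eq_mul]; exact hz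
  rw [ZMod.natCast_eq_zero_iff] at h1
  have h2 : p ^ n = p ^ (n - l) * p ^ l := by rw [← pow_add]; congr 1; omega
  have h3 : p ^ l ∣ z.val := by
    apply Nat.dvd_of_mul_dvd_mul_left (pow_pos hp.pos (n - l))
    rwa [← h2]
  obtain ⟨c, hc⟩ := h3
  refine ⟨(c : ZMod (p ^ n)), ?_⟩
  rw [← ZMod.natCast_zmod_val z, hc, nsmul_eq_mul, Nat.cast_mul]

theorem pow_nsmul_zero (x : ZMod (p ^ n)) : p ^ n • x = 0 := by
  rw [nsmul_eq_mul, ZMod.natCast_self, zero_mul]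

theorem pow_nsmul_zero' (x : ZMod (p ^ n) × ZMod (p ^ n)) : p ^ n • x = 0 := by
  ext <;> simp only [Prod.smul_fst, Prod.smul_snd, pow_nsmul_zero, Prod.fst_zero, Prod.snd_zero]

theorem exists_div (hp : p.Prime) {l : ℕ} (hl : l ≤ n) (z : ZMod (p ^ n) × ZMod (p ^ n))
    (hz : p ^ (n - l) • z = 0) : ∃ w, z = p ^ l • w := by
  obtain ⟨w1, h1⟩ := zmod_exists_div hp hl z.1 (by simpa using congrArg Prod.fst hz)
  obtain ⟨w2, h2⟩ := zmod_exists_div hp hl z.2 (by simpa using congrArg Prod.snd hz)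
  exact ⟨(w1, w2), Prod.ext h1 h2⟩

theorem card_torsion {l : ℕ} (hl : l ≤ n) :
    #{x : ZMod (p ^ n) × ZMod (p ^ n) | p ^ l • x = 0} = p ^ (2 * l) := by
  have : ({x : ZMod (p ^ n) × ZMod (p ^ n) | p ^ l • x = 0} : Finset _) =
      ({j : ZMod (p ^ n) | p ^ l • j = 0} : Finset _) ×ˢ
      ({j : ZMod (p ^ n) | p ^ l • j = 0} : Finset _) := by
    ext x
    simp only [mem_filter, mem_univ, true_and, mem_product, Prod.ext_iff, Prod.smul_fst,
      Prod.smul_snd, Prod.fst_zero, Prod.snd_zero]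
  rw [this, card_product, zmod_card_torsion hl]
  ring

/-- Level of an element. -/
noncomputable def lev (p n : ℕ) (x : ZMod (p ^ n) × ZMod (p ^ n)) : ℕ :=
  (addOrderOf x).factorization p

theorem addOrderOf_eq (hp : p.Prime) (x : ZMod (p ^ n) × ZMod (p ^ n)) :
    addOrderOf x = p ^ lev p n x := by
  have h := addOrderOf_dvd_of_nsmul_eq_zero (pow_nsmul_zero' x)
  obtain ⟨k, _, hk⟩ := (Nat.dvd_prime_pow hp).mp h
  rw [lev, hk]
  simp [hp.factorization_self]

theorem lev_le_iff (hp : p.Prime) (x : ZMod (p ^ n) × ZMod (p ^ n)) (l : ℕ) :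
    lev p n x ≤ l ↔ p ^ l • x = 0 := by
  rw [← addOrderOf_dvd_iff_nsmul_eq_zero, addOrderOf_eq hp, Nat.pow_dvd_pow_iff_le_right hp.one_lt]

theorem lev_le (hp : p.Prime) (x : ZMod (p ^ n) × ZMod (p ^ n)) : lev p n x ≤ n :=
  (lev_le_iff hp x n).mpr (pow_nsmul_zero' x)

theorem lev_eq_zero (hp : p.Prime) (x : ZMod (p ^ n) × ZMod (p ^ n)) :
    lev p n x = 0 ↔ x = 0 := by
  have := lev_le_iff hp x 0
  simpa using this

theorem lev_nsmul (hp : p.Prime) (x : ZMod (p ^ n) × ZMod (p ^ n)) :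
    lev p n (p • x) = lev p n x - 1 := by
  apply le_antisymm
  · rw [lev_le_iff hp, smul_smul, ← pow_succ, ← lev_le_iff hp]; omega
  · have : lev p n x ≤ lev p n (p • x) + 1 := by
      rw [lev_le_iff hp, pow_succ, ← smul_smul, ← lev_le_iff hp]
    omega

theorem lev_add (hp : p.Prime) (x t : ZMod (p ^ n) × ZMod (p ^ n)) (hx : 2 ≤ lev p n x)
    (ht : p • t = 0) : lev p n (x + t) = lev p n x := by
  have h1 : lev p n (p • (x + t)) = lev p n (p • x) := by rw [smul_add, ht, add_zero]
  rw [lev_nsmul hp, lev_nsmul hp] at h1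
  omega

theorem unit_of (hp : p.Prime) (hn : 1 ≤ n) (c : ZMod (p ^ n)) (hc : p ^ (n - 1) • c ≠ 0) :
    IsUnit c := by
  have h : ¬ p ∣ c.val := by
    rintro ⟨d, hd⟩
    apply hc
    rw [← ZMod.natCast_zmod_val c, hd, nsmul_eq_mul, ← Nat.cast_mul, ← mul_assoc, ← pow_succ,
      Nat.sub_add_cancel hn]
    simp
  rw [← ZMod.natCast_zmod_val c, ZMod.isUnit_iff_coprime]
  exact (Nat.Coprime.pow_left n ((Nat.Prime.coprime_iff_not_dvd hp).mpr h)).symm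

theorem not_unit_mul (hp : p.Prime) (hn : 1 ≤ n) (c : ZMod (p ^ n)) : ¬ IsUnit (p • c) := by
  intro h
  have h2 : p ^ (n - 1) • (p • c) = 0 := by
    rw [smul_smul, ← pow_succ, Nat.sub_add_cancel hn, pow_nsmul_zero]
  rw [nsmul_eq_mul (p ^ (n - 1)), h.mul_left_eq_zero, ZMod.natCast_eq_zero_iff,
    Nat.pow_dvd_pow_iff_le_right hp.one_lt] at h2
  omega

theorem unit_sum (hp : p.Prime) (hn : 1 ≤ n) (h : ZMod (p ^ n) → ℂ) :
    (p : ℂ) * ∑ j, h j = ∑ j, h (p • j) + p * ∑ j with IsUnit j, h j := by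
  have key : ∑ j, h (p • j) = p * ∑ j with ¬ IsUnit j, h j := by
    rw [← Finset.sum_fiberwise_of_maps_to (s := univ) (t := ({j : ZMod (p ^ n) | ¬ IsUnit j} : Finset _))
      (g := fun j : ZMod (p ^ n) => p • j) (fun j _ => by simpa using not_unit_mul hp hn j), mul_sum]
    apply Finset.sum_congr rfl
    intro z hz
    have hz' : ¬ IsUnit z := by simpa using hz
    have h0 : p ^ (n - 1) • z = 0 := by
      by_contra h0
      exact hz' (unit_of hp hn z h0)
    obtain ⟨w, hw⟩ := zmod_exists_div hp hn z h0
    rw [pow_one] at hw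
    rw [Finset.sum_congr rfl (g := fun _ => h z) (fun j hj => by rw [(mem_filter.mp hj).2]),
      sum_const, nsmul_eq_mul]
    congr 2
    have h1 := zmod_card_torsion (p := p) (n := n) hn
    rw [pow_one] at h1
    conv_rhs => rw [← h1]
    apply card_bij' (fun j _ => j - w) (fun j _ => j + w)
    · intro j hj
      have := (mem_filter.mp hj).2
      simp only [mem_filter, mem_univ, true_and, smul_sub, this, hw, sub_self]
    · intro j hj
      have := (mem_filter.mp hj).2
      simp only [mem_filter, mem_univ, true_and, smul_add, this, hw, zero_add]
    · intros; simp
    · intros; simp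
  rw [key, ← mul_add, ← Finset.sum_filter_add_sum_filter_not univ (fun j : ZMod (p ^ n) => IsUnit j)]
  ring

/-- symplectic form -/
def om {p n : ℕ} (x y : ZMod (p ^ n) × ZMod (p ^ n)) : ZMod (p ^ n) := x.1 * y.2 - x.2 * y.1

/-- symplectic character -/
noncomputable def ee {p n : ℕ} [NeZero (p ^ n)] (x y : ZMod (p ^ n) × ZMod (p ^ n)) : ℂ :=
  ZMod.stdAddChar (om x y)

theorem ee_add_left (x y z : ZMod (p ^ n) × ZMod (p ^ n)) : ee (x + y) z = ee x z * ee y z := by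
  rw [ee, ee, ee, ← AddChar.map_add_eq_mul]; congr 1; simp [om]; ring

theorem ee_add_right (x y z : ZMod (p ^ n) × ZMod (p ^ n)) : ee x (y + z) = ee x y * ee x z := by
  rw [ee, ee, ee, ← AddChar.map_add_eq_mul]; congr 1; simp [om]; ring

theorem ee_nsmul_left (k : ℕ) (x y : ZMod (p ^ n) × ZMod (p ^ n)) :
    ee (k • x) y = ee x (k • y) := by
  rw [ee, ee]; congr 1; simp [om]; ring

theorem ee_zero_left (y : ZMod (p ^ n) × ZMod (p ^ n)) : ee 0 y = 1 := by
  simp [ee, om]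
theorem ee_zero_right (y : ZMod (p ^ n) × ZMod (p ^ n)) : ee y 0 = 1 := by
  simp [ee, om]
theorem ee_neg_swap (x y : ZMod (p ^ n) × ZMod (p ^ n)) : ee x (-y) = ee y x := by
  rw [ee, ee]; congr 1; simp [om]; ring

theorem sum_std (b : ZMod (p ^ n)) :
    ∑ x : ZMod (p ^ n), (ZMod.stdAddChar (x * b) : ℂ) = if b = 0 then (p : ℂ) ^ n else 0 := by
  rw [AddChar.sum_mulShift b (ZMod.isPrimitive_stdAddChar (p ^ n)), ZMod.card]
  split_ifs <;> simp

theorem sum_ee (y : ZMod (p ^ n) × ZMod (p ^ n)) :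
    ∑ x, ee x y = if y = 0 then (p : ℂ) ^ (2 * n) else 0 := by
  rw [Fintype.sum_prod_type]
  have : ∀ a b : ZMod (p ^ n), ee (a, b) y =
      (ZMod.stdAddChar (a * y.2) : ℂ) * ZMod.stdAddChar (b * (- y.1)) := by
    intro a b
    rw [ee, ← AddChar.map_add_eq_mul]; congr 1; simp [om]; ring
  simp_rw [this, ← mul_sum, ← sum_mul, sum_std, neg_eq_zero, Prod.ext_iff, Prod.fst_zero,
    Prod.snd_zero]
  by_cases h1 : y.1 = 0 <;> by_cases h2 : y.2 = 0 <;> simp [h1, h2]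
  ring

theorem fiber_count (hp : p.Prime) (k : ℕ) (z : ZMod (p ^ n) × ZMod (p ^ n)) :
    ∑ t with k • t = 0, ee z t = (#{x : ZMod (p ^ n) × ZMod (p ^ n) | k • x = z} : ℂ) := by
  have h0 : (p : ℂ) ^ (2 * n) ≠ 0 := pow_ne_zero _ (by exact_mod_cast hp.ne_zero)
  apply mul_left_cancel₀ h0
  have e1 : ∑ w : ZMod (p ^ n) × ZMod (p ^ n), ∑ x : ZMod (p ^ n) × ZMod (p ^ n), ee w (k • x - z)
      = (p : ℂ) ^ (2 * n) * (#{x : ZMod (p ^ n) × ZMod (p ^ n) | k • x = z} : ℂ) := by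
    rw [Finset.sum_comm]
    simp_rw [sum_ee, sub_eq_zero]
    rw [← Finset.sum_filter, sum_const, nsmul_eq_mul]; ring
  have e2 : ∑ w : ZMod (p ^ n) × ZMod (p ^ n), ∑ x : ZMod (p ^ n) × ZMod (p ^ n), ee w (k • x - z)
      = (p : ℂ) ^ (2 * n) * ∑ t with k • t = 0, ee z t := by
    have : ∀ w x : ZMod (p ^ n) × ZMod (p ^ n), ee w (k • x - z) = ee x (- (k • w)) * ee z w := by
      intro w x
      rw [sub_eq_add_neg, ee_add_right, ee_neg_swap, ← ee_nsmul_left, ee_neg_swap]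
    simp_rw [this, ← sum_mul, sum_ee, neg_eq_zero, ite_mul, zero_mul]
    rw [← Finset.sum_filter, mul_sum]
  rw [← e1, e2]

end basics

section spectrum
open Finset
variable {p n : ℕ} [NeZero (p ^ n)]

/-- eigenvalue attached to `y` -/
noncomputable def theta {p n : ℕ} [NeZero (p ^ n)] (f : ZMod (p ^ n) × ZMod (p ^ n) → ℂ)
    (y : ZMod (p ^ n) × ZMod (p ^ n)) : ℂ := ∑ x, f x * ee x y

/-- the inhomogeneous term of the functional equation -/
noncomputable def gg (p : ℕ) (a : ℕ → ℕ) (l : ℕ) : ℂ :=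
  if l ≤ 1 then ((p : ℂ) - 1) * a 1 else p * a l

theorem abel_level (g : ℕ → ℂ) {m n : ℕ} (h : m ≤ n) :
    g m = g n + ∑ l ∈ range n, (g l - g (l + 1)) * (if m ≤ l then 1 else 0) := by
  induction n, h using Nat.le_induction with
  | base =>
    rw [Finset.sum_eq_zero, add_zero]
    intro l hl
    rw [if_neg (by have := mem_range.mp hl; omega), mul_zero]
  | succ n h ih =>
    rw [sum_range_succ, if_pos h, ih]; ring

theorem theta_unit (f : ZMod (p ^ n) × ZMod (p ^ n) → ℂ)
    (hu : ∀ (u : ZMod (p ^ n)) x, IsUnit u → f (u • x) = f x)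
    (u : ZMod (p ^ n)) (y) (h : IsUnit u) : theta f (u • y) = theta f y := by
  obtain ⟨u, rfl⟩ := h
  rw [theta, theta]
  apply Fintype.sum_equiv (MulAction.toPerm u)
  intro x
  simp only [MulAction.toPerm_apply, Units.smul_def]
  rw [hu _ _ u.isUnit]
  congr 1
  rw [ee, ee]; congr 1; simp [om]; ring

/-- coordinates with respect to a symplectic basis -/
def sympEquiv {p n : ℕ} (z y : ZMod (p ^ n) × ZMod (p ^ n)) (h : om z y = 1) :
    ZMod (p ^ n) × ZMod (p ^ n) ≃ ZMod (p ^ n) × ZMod (p ^ n) where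
  toFun q := q.1 • z + q.2 • y
  invFun x := (om x y, om z x)
  left_inv q := by
    simp only [om] at h
    ext
    · simp [om]; linear_combination q.1 * h
    · simp [om]; linear_combination q.2 * h
  right_inv x := by
    simp only [om] at h
    ext
    · simp [om]; linear_combination x.1 * h
    · simp [om]; linear_combination x.2 * h

theorem om_symp (z y : ZMod (p ^ n) × ZMod (p ^ n)) (h : om z y = 1) (i j : ZMod (p ^ n)) :
    om (i • z + j • y) y = i := by
  simp only [om] at h
  simp [om]; linear_combination i * h

theorem exists_symp (hp : p.Prime) (hn : 1 ≤ n) (y : ZMod (p ^ n) × ZMod (p ^ n))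
    (hy : lev p n y = n) : ∃ z, om z y = 1 := by
  have h : p ^ (n - 1) • y ≠ 0 := by
    intro h
    rw [← lev_le_iff hp] at h
    omega
  by_cases h1 : p ^ (n - 1) • y.1 = 0
  · have h2 : p ^ (n - 1) • y.2 ≠ 0 := fun h2 => h (Prod.ext h1 h2)
    obtain ⟨u, hu⟩ := unit_of hp hn _ h2
    exact ⟨(↑u⁻¹, 0), by simp [om, ← hu]⟩
  · obtain ⟨u, hu⟩ := unit_of hp hn _ h1
    exact ⟨(0, -↑u⁻¹), by simp [om, ← hu]⟩

theorem sum_theta_line (f : ZMod (p ^ n) × ZMod (p ^ n) → ℂ) (c : ℕ)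
    (z y : ZMod (p ^ n) × ZMod (p ^ n)) (h : om z y = 1) :
    ∑ j : ZMod (p ^ n), theta f ((c • j) • y) =
      (p : ℂ) ^ n * ∑ i : ZMod (p ^ n) with c • i = 0, ∑ j : ZMod (p ^ n), f (i • z + j • y) := by
  have e1 : ∀ (x : ZMod (p ^ n) × ZMod (p ^ n)) (j : ZMod (p ^ n)),
      ee x ((c • j) • y) = ZMod.stdAddChar (j * (c • om x y)) := by
    intro x j
    rw [ee]; congr 1; simp [om]; ring
  simp only [theta]
  rw [Finset.sum_comm]
  simp_rw [e1, ← mul_sum, sum_std]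
  rw [← (sympEquiv z y h).sum_comp, Fintype.sum_prod_type, mul_sum, Finset.sum_filter]
  apply Finset.sum_congr rfl
  intro i _
  simp only [sympEquiv, Equiv.coe_fn_mk, om_symp z y h]
  split_ifs with hi
  · rw [mul_sum]
    exact Finset.sum_congr rfl (fun _ _ => mul_comm _ _)
  · simp

theorem sum_line_shift (hn : 1 ≤ n) (f : ZMod (p ^ n) × ZMod (p ^ n) → ℂ)
    (z y : ZMod (p ^ n) × ZMod (p ^ n)) (h : om z y = 1) :
    (p : ℂ) * ∑ i : ZMod (p ^ n) with p • i = 0, ∑ j : ZMod (p ^ n), f (i • z + j • y) =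
      ∑ j : ZMod (p ^ n), ∑ t with p • t = 0, f (j • y + t) := by
  have hc : ∑ s : ZMod (p ^ n) with p • s = 0, (1 : ℂ) = p := by
    have := zmod_card_torsion (p := p) (n := n) hn
    rw [pow_one] at this
    rw [sum_const, this]; simp
  have e1 : ∀ j : ZMod (p ^ n), ∑ t with p • t = 0, f (j • y + t) =
      ∑ i : ZMod (p ^ n) with p • i = 0, ∑ s : ZMod (p ^ n) with p • s = 0, f (i • z + (j + s) • y) := by
    intro j
    rw [Finset.sum_filter, ← (sympEquiv z y h).sum_comp, Fintype.sum_prod_type, Finset.sum_filter]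
    apply Finset.sum_congr rfl
    intro i _
    rw [Finset.sum_filter]
    have hz : ∀ s, p • (sympEquiv z y h (i, s)) = 0 ↔ (p • i = 0 ∧ p • s = 0) := by
      intro s
      have : p • (sympEquiv z y h (i, s)) = sympEquiv z y h (p • i, p • s) := by
        simp only [sympEquiv, Equiv.coe_fn_mk, smul_add, smul_assoc]
      have h0 : sympEquiv z y h (0, 0) = 0 := by simp [sympEquiv]
      rw [this, ← h0, (sympEquiv z y h).injective.eq_iff, Prod.ext_iff]
    simp_rw [hz]
    split_ifs with hi
    · apply Finset.sum_congr rfl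
      intro s _
      simp only [hi, true_and, sympEquiv, Equiv.coe_fn_mk]
      split_ifs
      · congr 1; rw [add_smul]; abel
      · rfl
    · simp only [hi, false_and, if_false, sum_const_zero]
  simp_rw [e1]
  conv_rhs => rw [Finset.sum_comm]
  rw [mul_sum]
  apply Finset.sum_congr rfl
  intro i _
  conv_rhs => rw [Finset.sum_comm]
  rw [← hc, sum_mul]
  apply Finset.sum_congr rfl
  intro s _
  rw [one_mul]
  exact (Fintype.sum_equiv (Equiv.addRight s) _ (fun j => f (i • z + j • y)) (fun _ => rfl)).symm

theorem sum_gg_line (hp : p.Prime) (g : ℕ → ℂ) (z y : ZMod (p ^ n) × ZMod (p ^ n))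
    (h : om z y = 1) :
    ∑ j : ZMod (p ^ n), g (lev p n (j • y)) =
      g n * p ^ n + ∑ l ∈ range n, (g l - g (l + 1)) * p ^ l := by
  have e1 : ∀ j : ZMod (p ^ n), g (lev p n (j • y)) = g n + ∑ l ∈ range n,
      (g l - g (l + 1)) * (if p ^ l • j = 0 then 1 else 0) := by
    intro j
    rw [abel_level g (lev_le hp (j • y))]
    congr 1
    apply Finset.sum_congr rfl
    intro l _
    congr 1
    refine if_congr ?_ rfl rfl
    rw [lev_le_iff hp, ← smul_assoc]
    constructor
    · intro hh
      have : om z ((p ^ l • j) • y) = 0 := by rw [hh]; simp [om]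
      have h2 : om z ((p ^ l • j) • y) = (p ^ l • j) * om z y := by simp [om]; ring
      rw [h2, h, mul_one] at this
      exact this
    · intro hh; rw [hh, zero_smul]
  simp_rw [e1]
  rw [sum_add_distrib, Finset.sum_comm, sum_const, card_univ, ZMod.card, nsmul_eq_mul]
  push_cast
  rw [mul_comm]
  congr 1
  apply Finset.sum_congr rfl
  intro l hl
  rw [← mul_sum, Finset.sum_boole, zmod_card_torsion (mem_range.mp hl).le]
  push_cast; rfl

theorem theta_top (hp : p.Prime) (hn : 1 ≤ n) (f : ZMod (p ^ n) × ZMod (p ^ n) → ℂ) (g : ℕ → ℂ)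
    (hu : ∀ (u : ZMod (p ^ n)) x, IsUnit u → f (u • x) = f x)
    (HF : ∀ x, ∑ t with p • t = 0, f (x + t) = p * f (p • x) + g (lev p n x))
    (y : ZMod (p ^ n) × ZMod (p ^ n)) (hy : lev p n y = n) :
    (p : ℂ) * (p - 1) * theta f y = p * (p - 1) * p ^ n * f y -
      (g n * p ^ n + ∑ l ∈ range n, (g l - g (l + 1)) * p ^ l) := by
  obtain ⟨z, hz⟩ := exists_symp hp hn y hy
  have hp0 : (p : ℂ) ≠ 0 := by exact_mod_cast hp.ne_zero
  have hN0 : (p : ℂ) ^ n ≠ 0 := pow_ne_zero _ hp0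
  have u1 := unit_sum hp hn (fun j => theta f (j • y))
  have u2 := unit_sum hp hn (fun j => f (j • y))
  have u3 := unit_sum (p := p) (n := n) hp hn (fun _ => 1)
  rw [Finset.sum_congr rfl (g := fun _ => theta f y)
    (fun j hj => theta_unit f hu j y (mem_filter.mp hj).2)] at u1
  rw [Finset.sum_congr rfl (g := fun _ => f y) (s₁ := ({j : ZMod (p ^ n) | IsUnit j} : Finset _))
    (fun j hj => hu j y (mem_filter.mp hj).2)] at u2
  simp only [sum_const, nsmul_eq_mul (α := ℂ), card_univ, ZMod.card, mul_one] at u1 u2 u3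
  set U : ℂ := (#({j : ZMod (p ^ n) | IsUnit j} : Finset _) : ℂ)
  push_cast at u3
  have s1 := sum_theta_line f 1 z y hz
  have s2 := sum_theta_line f p z y hz
  simp only [one_smul] at s1
  have s3 : ∑ i : ZMod (p ^ n) with i = 0, ∑ j : ZMod (p ^ n), f (i • z + j • y) = ∑ j : ZMod (p ^ n), f (j • y) := by
    rw [Finset.filter_eq' univ (0 : ZMod (p ^ n))]; simp
  rw [s3] at s1
  have s4 := sum_line_shift hn f z y hz
  simp_rw [HF] at s4
  rw [sum_add_distrib, sum_gg_line hp g z y hz, ← mul_sum] at s4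
  have s5 : ∑ j : ZMod (p ^ n), f ((p • j) • y) = ∑ j : ZMod (p ^ n), f (p • j • y) := by
    simp only [smul_assoc]
  rw [s1, s2] at u1
  rw [s5] at u2
  apply mul_left_cancel₀ hN0
  have hU : (p : ℂ) * U = p ^ n * (p - 1) := by linear_combination -u3
  linear_combination (-(p : ℂ) * theta f y + p * p ^ n * f y) * hU - p * u1 + p * p ^ n * u2
    - p ^ n * s4

end spectrum

section recursion
open Finset
variable {p n : ℕ} [NeZero (p ^ n)]

theorem theta_step (hp : p.Prime) (hn : 1 ≤ n) (f : ZMod (p ^ n) × ZMod (p ^ n) → ℂ) (g : ℕ → ℂ)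
    (HF : ∀ x, ∑ t with p • t = 0, f (x + t) = p * f (p • x) + g (lev p n x))
    (y : ZMod (p ^ n) × ZMod (p ^ n)) :
    (p : ℂ) ^ 2 * theta f (p • y) = p * ∑ t with p • t = 0, theta f (y + t) +
      ∑ x, g (lev p n x) * ee x (p • y) := by
  have hc : ∑ t : ZMod (p ^ n) × ZMod (p ^ n) with p • t = 0, (1 : ℂ) = (p : ℂ) ^ 2 := by
    have := card_torsion (p := p) (n := n) hn
    rw [pow_one] at this
    rw [sum_const, this]; simp
  have e1 : (p : ℂ) ^ 2 * theta f (p • y) = ∑ x, (∑ t with p • t = 0, f (x + t)) * ee x (p • y) := by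
    simp_rw [sum_mul]
    rw [Finset.sum_comm, ← hc, sum_mul]
    apply Finset.sum_congr rfl
    intro t ht
    have ht' := (mem_filter.mp ht).2
    rw [one_mul, theta]
    refine (Fintype.sum_equiv (Equiv.addRight t) _ (fun x => f x * ee x (p • y)) ?_).symm
    intro x
    simp only [Equiv.coe_addRight]
    rw [ee_add_left, ← ee_nsmul_left p t, ht', ee_zero_left, mul_one]
  have e2 : ∑ t with p • t = 0, theta f (y + t) = ∑ x, f (p • x) * ee x (p • y) := by
    simp only [theta]
    rw [Finset.sum_comm]
    simp_rw [ee_add_right, ← mul_assoc, ← mul_sum, fiber_count hp]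
    rw [← Finset.sum_fiberwise univ (fun x : ZMod (p ^ n) × ZMod (p ^ n) => p • x)
      (fun x => f (p • x) * ee x (p • y))]
    apply Finset.sum_congr rfl
    intro z _
    rw [Finset.sum_congr rfl (g := fun _ => f z * ee z y)
      (fun x hx => by rw [← ee_nsmul_left, (mem_filter.mp hx).2]), sum_const, nsmul_eq_mul]
    ring
  rw [e1, e2, mul_sum, ← sum_add_distrib]
  apply Finset.sum_congr rfl
  intro x _
  rw [HF]; ring

theorem level_sum (hp : p.Prime) {l : ℕ} (hl : l ≤ n) (y : ZMod (p ^ n) × ZMod (p ^ n)) :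
    ∑ x with p ^ l • x = 0, ee x y = if l ≤ n - lev p n y then (p : ℂ) ^ (2 * l) else 0 := by
  split_ifs with h
  · have hy : p ^ (n - l) • y = 0 := by
      rw [← lev_le_iff hp]
      have := lev_le hp y
      omega
    obtain ⟨w, rfl⟩ := exists_div hp hl y hy
    rw [Finset.sum_congr rfl (g := fun _ => (1 : ℂ))
      (fun x hx => by rw [← ee_nsmul_left, (mem_filter.mp hx).2, ee_zero_left]), sum_const,
      card_torsion hl]
    simp
  · have : ∀ x, ee x y = ee (-y) x := fun x => by rw [← ee_neg_swap x (-y), neg_neg]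
    simp_rw [this]
    rw [fiber_count hp]
    rw [Nat.cast_eq_zero, card_eq_zero, filter_eq_empty_iff]
    intro x _ hx
    apply h
    have : lev p n y ≤ n - l := by
      rw [lev_le_iff hp, ← neg_eq_zero, ← smul_neg, ← hx, smul_smul, ← pow_add,
        Nat.sub_add_cancel hl, pow_nsmul_zero']
    omega

theorem level_weight (hp : p.Prime) (g : ℕ → ℂ) (y : ZMod (p ^ n) × ZMod (p ^ n))
    (hy : 1 ≤ lev p n y) :
    ∑ x, g (lev p n x) * ee x y =
      ∑ l ∈ range (n - lev p n y + 1), (g l - g (l + 1)) * (p : ℂ) ^ (2 * l) := by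
  have e1 : ∀ x, g (lev p n x) * ee x y = g n * ee x y + ∑ l ∈ range n,
      (g l - g (l + 1)) * (if p ^ l • x = 0 then ee x y else 0) := by
    intro x
    rw [abel_level g (lev_le hp x), add_mul, sum_mul]
    congr 1
    apply Finset.sum_congr rfl
    intro l _
    rw [mul_assoc]
    congr 1
    simp only [lev_le_iff hp, ite_mul, one_mul, zero_mul]
  have hy0 : y ≠ 0 := by
    intro h
    rw [← lev_eq_zero hp] at h
    omega
  simp_rw [e1]
  rw [sum_add_distrib, ← mul_sum, sum_ee, if_neg hy0, mul_zero, zero_add, Finset.sum_comm]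
  have hle := lev_le hp y
  rw [← Finset.sum_subset (s₁ := range (n - lev p n y + 1)) (s₂ := range n)]
  · apply Finset.sum_congr rfl
    intro l hl
    rw [mem_range] at hl
    rw [← mul_sum, ← Finset.sum_filter, level_sum hp (by omega), if_pos (by omega)]
  · apply range_subset_range.mpr; omega
  · intro l h1 h2
    rw [mem_range] at h1 h2
    rw [← mul_sum, ← Finset.sum_filter, level_sum hp (by omega), if_neg (by omega), mul_zero]

/-- partial sums of `p^l (a_l - a_{l+1})` -/
def PP (p : ℕ) (a : ℕ → ℕ) (r : ℕ) : ℤ := ∑ l ∈ Ico 2 r, (p : ℤ) ^ l * (a l - a (l + 1))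

/-- level constants of the eigenvalues -/
def TT (p n : ℕ) (a : ℕ → ℕ) : ℕ → ℤ
  | 0 => - ∑ l ∈ range n, (p : ℤ) ^ l * a (l + 1)
  | s + 1 => TT p n a s + (p : ℤ) ^ s * (PP p a (s + 2) - PP p a (n - s))

/-- the weight term -/
def VV (p : ℕ) (a : ℕ → ℕ) (s : ℕ) : ℤ :=
  ((p : ℤ) - 1) * a 1 - p * a 2 + ∑ l ∈ range s, (p : ℤ) ^ (2 * l + 3) * (a (l + 2) - a (l + 3))

theorem PP_succ (p : ℕ) (a : ℕ → ℕ) (r : ℕ) (hr : 2 ≤ r) :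
    PP p a (r + 1) = PP p a r + (p : ℤ) ^ r * (a r - a (r + 1)) := by
  rw [PP, sum_Ico_succ_top hr, PP]

theorem ident_zero (p : ℕ) (a : ℕ → ℕ) (n : ℕ) (hn : 2 ≤ n) :
    (p : ℤ) ^ n * a n + (p - 1) * TT p n a 0 + VV p a 0 = - PP p a n := by
  induction n, hn using Nat.le_induction with
  | base => simp [TT, VV, PP, sum_range_succ]; ring
  | succ n hn ih =>
    rw [PP_succ p a n hn]
    simp only [TT, VV, sum_range_succ _ n, range_zero, sum_empty] at ih ⊢
    linear_combination ih

theorem ident (p : ℕ) (a : ℕ → ℕ) (n s : ℕ) (hs : s + 2 ≤ n) :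
    (p : ℤ) ^ n * a (n - s) + (p - 1) * TT p n a s + VV p a s =
      (p : ℤ) ^ s * (PP p a (s + 2) - PP p a (n - s)) := by
  induction s with
  | zero =>
    have := ident_zero p a n hs
    simp only [Nat.sub_zero, pow_zero, one_mul]
    rw [this]; simp [PP]
  | succ s ih =>
    have ih := ih (by omega)
    obtain ⟨q, rfl⟩ : ∃ q, n = s + 3 + q := ⟨n - (s + 3), by omega⟩
    have h1 : s + 3 + q - s = (q + 2) + 1 := by omega
    have h2 : s + 3 + q - (s + 1) = q + 2 := by omega
    rw [h1] at ih
    rw [h2]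
    have h3 := PP_succ p a (q + 2) (by omega)
    have h4 := PP_succ p a (s + 2) (by omega)
    rw [h3] at ih
    have hV : VV p a (s + 1) = VV p a s + (p : ℤ) ^ (2 * s + 3) * (a (s + 2) - a (s + 3)) := by
      rw [VV, sum_range_succ, VV]; ring
    rw [hV, show s + 1 + 2 = s + 2 + 1 by ring, h4, TT, h1, h3]
    linear_combination ih

theorem weight_VV (p : ℕ) (a : ℕ → ℕ) (s : ℕ) :
    ∑ l ∈ range (s + 2), (gg p a l - gg p a (l + 1)) * (p : ℂ) ^ (2 * l) =
      (p : ℂ) ^ 2 * (VV p a s : ℤ) := by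
  induction s with
  | zero => simp [sum_range_succ, gg, VV]; ring
  | succ s ih =>
    rw [show s + 1 + 2 = s + 2 + 1 by ring, sum_range_succ, ih]
    have hV : VV p a (s + 1) = VV p a s + (p : ℤ) ^ (2 * s + 3) * (a (s + 2) - a (s + 3)) := by
      rw [VV, sum_range_succ, VV]; ring
    rw [hV]
    simp only [gg]
    rw [if_neg (by omega), if_neg (by omega)]
    push_cast; ring

theorem top_TT (p : ℕ) (a : ℕ → ℕ) (n : ℕ) (hn : 1 ≤ n) :
    gg p a n * (p : ℂ) ^ n + ∑ l ∈ range n, (gg p a l - gg p a (l + 1)) * (p : ℂ) ^ l =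
      - ((p : ℂ) * (p - 1) * (TT p n a 0 : ℤ)) := by
  induction n, hn using Nat.le_induction with
  | base => simp [gg, TT]; ring
  | succ n hn ih =>
    rw [sum_range_succ]
    have hT : TT p (n + 1) a 0 = TT p n a 0 - (p : ℤ) ^ n * a (n + 1) := by
      simp only [TT, sum_range_succ]; ring
    rw [hT]
    have hg : gg p a (n + 1) = p * a (n + 1) := by rw [gg, if_neg (by omega)]
    push_cast
    linear_combination ih + ((p : ℂ) ^ (n + 1) - p ^ n) * hg

theorem theta_formula (hp : p.Prime) (hn : 1 ≤ n) (f : ZMod (p ^ n) × ZMod (p ^ n) → ℂ)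
    (a : ℕ → ℕ)
    (hu : ∀ (u : ZMod (p ^ n)) x, IsUnit u → f (u • x) = f x)
    (HF : ∀ x, ∑ t with p • t = 0, f (x + t) = p * f (p • x) + gg p a (lev p n x))
    (s : ℕ) (hs : s < n) (y : ZMod (p ^ n) × ZMod (p ^ n)) (hy : lev p n y = n - s) :
    theta f y = (p : ℂ) ^ n * f y + (TT p n a s : ℤ) := by
  have hp0 : (p : ℂ) ≠ 0 := by exact_mod_cast hp.ne_zero
  have hp1 : (p : ℂ) - 1 ≠ 0 := by
    rw [sub_ne_zero]; exact_mod_cast hp.one_lt.ne'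
  induction s generalizing y with
  | zero =>
    have := theta_top hp hn f (gg p a) hu HF y hy
    rw [top_TT p a n hn] at this
    apply mul_left_cancel₀ (mul_ne_zero hp0 hp1)
    linear_combination this
  | succ s ih =>
    obtain ⟨w, hw⟩ := exists_div hp hn y (by rw [← lev_le_iff hp]; omega)
    rw [pow_one] at hw
    have hlw : lev p n w = n - s := by
      have := lev_nsmul hp w
      rw [← hw] at this
      omega
    have h1 := theta_step hp hn f (gg p a) HF w
    rw [level_weight hp _ _ (by rw [← hw]; omega), ← hw, hy,
      show n - (n - (s + 1)) + 1 = s + 2 by omega, weight_VV] at h1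
    rw [Finset.sum_congr rfl (g := fun t => (p : ℂ) ^ n * f (w + t) + (TT p n a s : ℤ))
      (fun t ht => ih (by omega) (w + t) (by
        rw [lev_add hp _ _ (by omega) (mem_filter.mp ht).2, hlw])), sum_add_distrib, ← mul_sum,
      HF, ← hw, hlw, sum_const] at h1
    have hc := card_torsion (p := p) (n := n) hn
    rw [pow_one] at hc
    rw [hc, gg, if_neg (by omega), nsmul_eq_mul] at h1
    have h2 := congrArg (fun z : ℤ => (z : ℂ)) (ident p a n s (by omega))
    rw [TT]
    push_cast at h1 h2 ⊢
    apply mul_left_cancel₀ (pow_ne_zero 2 hp0)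
    linear_combination h1 + (p : ℂ) ^ 2 * h2

end recursion

section homog
open Finset
variable {p n : ℕ} [NeZero (p ^ n)]

theorem len_zmultiples (x : ZMod (p ^ n) × ZMod (p ^ n)) :
    len p n (AddSubgroup.zmultiples x) = lev p n x := by
  rw [len, lev, Nat.card_zmultiples]

theorem father_zmultiples (x : ZMod (p ^ n) × ZMod (p ^ n)) :
    father p n (AddSubgroup.zmultiples x) = AddSubgroup.zmultiples (p • x) := by
  rw [father, AddMonoidHom.map_zmultiples]; rfl

theorem zmultiples_unit_le (u : ZMod (p ^ n)) (x : ZMod (p ^ n) × ZMod (p ^ n)) :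
    AddSubgroup.zmultiples (u • x) ≤ AddSubgroup.zmultiples x := by
  rw [AddSubgroup.zmultiples_le, AddSubgroup.mem_zmultiples_iff]
  refine ⟨(u.val : ℤ), ?_⟩
  rw [natCast_zsmul, ← Nat.cast_smul_eq_nsmul (ZMod (p ^ n)), ZMod.natCast_zmod_val]

theorem zmultiples_unit (u : ZMod (p ^ n)) (x : ZMod (p ^ n) × ZMod (p ^ n)) (h : IsUnit u) :
    AddSubgroup.zmultiples (u • x) = AddSubgroup.zmultiples x := by
  apply le_antisymm (zmultiples_unit_le u x)
  obtain ⟨v, rfl⟩ := h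
  have := zmultiples_unit_le (↑v⁻¹ : ZMod (p ^ n)) ((v : ZMod (p ^ n)) • x)
  rwa [smul_smul, Units.inv_mul, one_smul] at this

theorem zmultiples_eq_of_mem (hp : p.Prime) (g x : ZMod (p ^ n) × ZMod (p ^ n))
    (hg : g ∈ AddSubgroup.zmultiples x) (hl : lev p n g = lev p n x) :
    AddSubgroup.zmultiples g = AddSubgroup.zmultiples x := by
  apply AddSubgroup.eq_of_le_of_card_ge (AddSubgroup.zmultiples_le.mpr hg)
  rw [Nat.card_zmultiples, Nat.card_zmultiples, addOrderOf_eq hp, addOrderOf_eq hp, hl]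

theorem lev_eq_of_zmultiples (g x : ZMod (p ^ n) × ZMod (p ^ n))
    (h : AddSubgroup.zmultiples g = AddSubgroup.zmultiples x) : lev p n g = lev p n x := by
  rw [← len_zmultiples, h, len_zmultiples]

open scoped Classical in
theorem card_sub_torsion (hp : p.Prime) (x : ZMod (p ^ n) × ZMod (p ^ n)) (hx : 1 ≤ lev p n x) :
    #{t | t ∈ AddSubgroup.zmultiples x ∧ p • t = 0} = p := by
  have h1 : #{t : AddSubgroup.zmultiples x | p • t = 0} = p := by
    apply cyc_card_torsion
    rw [← Nat.card_eq_fintype_card, Nat.card_zmultiples, addOrderOf_eq hp]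
    exact dvd_pow_self p (by omega)
  conv_rhs => rw [← h1]
  symm
  apply card_bij (fun (t : AddSubgroup.zmultiples x) _ => (t : ZMod (p ^ n) × ZMod (p ^ n)))
  · intro t ht
    have := (mem_filter.mp ht).2
    simp only [mem_filter, mem_univ, true_and]
    exact ⟨t.2, by simpa using congrArg Subtype.val this⟩
  · intro s _ t _ h; exact Subtype.ext h
  · intro t ht
    have := (mem_filter.mp ht).2
    exact ⟨⟨t, this.1⟩, by simp only [mem_filter, mem_univ, true_and]; exact Subtype.ext (by simpa using this.2), rfl⟩

open scoped Classical in
theorem fiber_nonzero (hp : p.Prime) (h x : ZMod (p ^ n) × ZMod (p ^ n)) (hh : h ≠ 0)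
    (hx : AddSubgroup.zmultiples (p • x) = AddSubgroup.zmultiples h) :
    #{g | p • g = h ∧ AddSubgroup.zmultiples g = AddSubgroup.zmultiples x} = p := by
  have hlh : 1 ≤ lev p n h := by
    by_contra hc
    exact hh ((lev_eq_zero hp h).mp (by omega))
  have hl := lev_eq_of_zmultiples _ _ hx
  rw [lev_nsmul hp] at hl
  have hm : h ∈ AddSubgroup.zmultiples (p • x) := by
    rw [hx]; exact AddSubgroup.mem_zmultiples h
  obtain ⟨k, hk⟩ := AddSubgroup.mem_zmultiples_iff.mp hm
  have hg1 : p • (k • x) = h := by rw [← hk, smul_comm]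
  have hg1m : k • x ∈ AddSubgroup.zmultiples x := AddSubgroup.mem_zmultiples_iff.mpr ⟨k, rfl⟩
  conv_rhs => rw [← card_sub_torsion hp x (by omega)]
  apply card_bij' (fun g _ => g - k • x) (fun t _ => t + k • x)
  · intro g hg
    obtain ⟨h1, h2⟩ := (mem_filter.mp hg).2
    simp only [mem_filter, mem_univ, true_and]
    refine ⟨AddSubgroup.sub_mem _ ?_ hg1m, by rw [smul_sub, h1, hg1, sub_self]⟩
    rw [← h2]; exact AddSubgroup.mem_zmultiples g
  · intro t ht
    obtain ⟨h1, h2⟩ := (mem_filter.mp ht).2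
    simp only [mem_filter, mem_univ, true_and]
    have h3 : p • (t + k • x) = h := by rw [smul_add, h2, hg1, zero_add]
    refine ⟨h3, zmultiples_eq_of_mem hp _ _ (AddSubgroup.add_mem _ h1 hg1m) ?_⟩
    have := lev_nsmul hp (t + k • x)
    rw [h3] at this
    omega
  · intros; simp
  · intros; simp

open scoped Classical in
theorem fiber_zero (hp : p.Prime) (x : ZMod (p ^ n) × ZMod (p ^ n)) (hx0 : x ≠ 0)
    (hx : p • x = 0) :
    #{g | p • g = 0 ∧ AddSubgroup.zmultiples g = AddSubgroup.zmultiples x} = p - 1 := by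
  have hlx : lev p n x = 1 := by
    have h1 : lev p n x ≤ 1 := by rw [lev_le_iff hp, pow_one, hx]
    have h2 : lev p n x ≠ 0 := fun h => hx0 ((lev_eq_zero hp x).mp h)
    omega
  have h1 : ({g | p • g = 0 ∧ AddSubgroup.zmultiples g = AddSubgroup.zmultiples x} : Finset _) =
      ({t | t ∈ AddSubgroup.zmultiples x ∧ p • t = 0} : Finset _).erase 0 := by
    ext g
    simp only [mem_filter, mem_univ, true_and, mem_erase]
    constructor
    · rintro ⟨h1, h2⟩
      refine ⟨?_, ?_, h1⟩
      · rintro rfl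
        have := lev_eq_of_zmultiples _ _ h2
        rw [(lev_eq_zero hp 0).mpr rfl] at this
        omega
      · rw [← h2]; exact AddSubgroup.mem_zmultiples g
    · rintro ⟨h1, h2, h3⟩
      refine ⟨h3, zmultiples_eq_of_mem hp _ _ h2 ?_⟩
      have h4 : lev p n g ≤ 1 := by rw [lev_le_iff hp, pow_one, h3]
      have h5 : lev p n g ≠ 0 := fun h => h1 ((lev_eq_zero hp g).mp h)
      omega
  rw [h1, card_erase_of_mem, card_sub_torsion hp x (by omega)]
  simp [AddSubgroup.zero_mem]

open scoped Classical in
theorem count_sons (S : Set (AddSubgroup (ZMod (p ^ n) × ZMod (p ^ n))))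
    (h : ZMod (p ^ n) × ZMod (p ^ n)) (c : ℕ)
    (hc : ∀ x, AddSubgroup.zmultiples (p • x) = AddSubgroup.zmultiples h →
      AddSubgroup.zmultiples x ∈ S →
      #{g | p • g = h ∧ AddSubgroup.zmultiples g = AddSubgroup.zmultiples x} = c) :
    #{g | p • g = h ∧ AddSubgroup.zmultiples g ∈ S} =
      Nat.card {F : AddSubgroup (ZMod (p ^ n) × ZMod (p ^ n)) //
        IsCyc p n F ∧ father p n F = AddSubgroup.zmultiples h ∧ F ∈ S} * c := by
  rw [Nat.card_eq_fintype_card, Fintype.card_subtype]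
  rw [Finset.card_eq_sum_card_fiberwise (f := fun g => AddSubgroup.zmultiples g)
    (t := ({F | IsCyc p n F ∧ father p n F = AddSubgroup.zmultiples h ∧ F ∈ S} : Finset _))]
  · rw [Finset.sum_congr rfl (g := fun _ => c), sum_const, smul_eq_mul]
    intro F hF
    obtain ⟨⟨x, rfl⟩, h2, h3⟩ := (mem_filter.mp hF).2
    rw [father_zmultiples] at h2
    rw [← hc x h2 h3, filter_filter]
    congr 1
    ext g
    simp only [mem_filter, mem_univ, true_and]
    constructor
    · rintro ⟨⟨h1, h2⟩, h3⟩; exact ⟨h1, h3⟩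
    · rintro ⟨h1, h4⟩; exact ⟨⟨h1, by rw [h4]; exact h3⟩, h4⟩
  · intro g hg
    obtain ⟨h1, h2⟩ := (mem_filter.mp hg).2
    simp only [coe_filter, mem_univ, true_and, Set.mem_ofPred_eq]
    exact ⟨⟨g, rfl⟩, by rw [father_zmultiples, h1], h2⟩

open scoped Classical in
/-- indicator of the connection set -/
noncomputable def ff {p n : ℕ} (S : Set (AddSubgroup (ZMod (p ^ n) × ZMod (p ^ n))))
    (x : ZMod (p ^ n) × ZMod (p ^ n)) : ℂ := if AddSubgroup.zmultiples x ∈ S then 1 else 0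

theorem ff_unit (S : Set (AddSubgroup (ZMod (p ^ n) × ZMod (p ^ n))))
    (u : ZMod (p ^ n)) (x) (h : IsUnit u) : ff S (u • x) = ff S x := by
  rw [ff, ff, zmultiples_unit u x h]

open scoped Classical in
theorem ff_HF (hp : p.Prime) (hn : 1 ≤ n) (a : ℕ → ℕ)
    (S : Set (AddSubgroup (ZMod (p ^ n) × ZMod (p ^ n)))) (hS : IsHomog p n S a) (x) :
    ∑ t with p • t = 0, ff S (x + t) = p * ff S (p • x) + gg p a (lev p n x) := by
  have e1 : ∑ t with p • t = 0, ff S (x + t) =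
      (#{g | p • g = p • x ∧ AddSubgroup.zmultiples g ∈ S} : ℂ) := by
    have : ∀ g, (if p • g = p • x then ff S g else 0) =
        if (p • g = p • x ∧ AddSubgroup.zmultiples g ∈ S) then 1 else 0 := by
      intro g
      rw [ff, ite_and]
    rw [← Finset.sum_boole]
    simp_rw [← this]
    rw [Finset.sum_filter]
    apply Fintype.sum_equiv (Equiv.addLeft x)
    intro t
    simp only [Equiv.coe_addLeft, smul_add, add_eq_left]
  have hl : lev p n (p • x) < n := by
    rw [lev_nsmul hp]; have := lev_le hp x; omega
  have hH := hS.2 (AddSubgroup.zmultiples (p • x)) ⟨_, rfl⟩ (by rw [len_zmultiples]; exact hl)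
  rw [len_zmultiples] at hH
  rw [e1]
  by_cases hx : p • x = 0
  · have hlx : lev p n x ≤ 1 := by rw [lev_le_iff hp, pow_one, hx]
    have h0 : AddSubgroup.zmultiples (p • x) ∉ S := by
      rw [hx, AddSubgroup.zmultiples_zero_eq_bot]; exact hS.1
    rw [count_sons S (p • x) (p - 1), hH.2 h0, ff, if_neg h0, gg, if_pos hlx, hx,
      (lev_eq_zero hp 0).mpr rfl]
    · push_cast [Nat.cast_sub hp.one_le]; ring
    · intro y hy1 hy2
      rw [hx, AddSubgroup.zmultiples_zero_eq_bot, AddSubgroup.zmultiples_eq_bot] at hy1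
      rw [hx]
      apply fiber_zero hp y _ hy1
      rintro rfl
      rw [AddSubgroup.zmultiples_zero_eq_bot] at hy2
      exact hS.1 hy2
  · have hlx : ¬ lev p n x ≤ 1 := by rw [lev_le_iff hp, pow_one]; exact hx
    rw [count_sons S (p • x) p (fun y hy1 _ => fiber_nonzero hp _ y hx hy1), ff, gg, if_neg hlx]
    rw [lev_nsmul hp, Nat.sub_add_cancel (by omega)] at hH
    split_ifs with h
    · rw [hH.1 h]; push_cast; ring
    · rw [hH.2 h]; push_cast; ring

end homog

section arith
open Finset

theorem small_dvd {p : ℕ} (x : ℤ) (h1 : x < p) (h2 : -x < p) (h : (p : ℤ) ∣ x) : x = 0 :=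
  Int.eq_zero_of_abs_lt_dvd h (abs_lt.mpr ⟨by linarith, h1⟩)

theorem arith_pair {p n : ℕ} (hp : p.Prime) (a : ℕ → ℕ)
    (ham : ∀ i, 2 ≤ i → i ≤ n → a i ≤ p - 1)
    (H : ∀ s, s + 1 < n → PP p a (s + 2) = PP p a (n - s)) (j : ℕ) (hj : 2 ≤ j)
    (hjn : 2 * j < n + 1) : a j = a (j + 1) ∧ a (n + 1 - j) = a (n + 2 - j) := by
  have hp2 := hp.two_le
  have hp0 : (p : ℤ) ≠ 0 := by exact_mod_cast hp.ne_zero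
  have h1 := H (j - 2) (by omega)
  have h2 := H (j - 1) (by omega)
  have e1 : j - 2 + 2 = j := by omega
  have e2 : n - (j - 2) = (n + 1 - j) + 1 := by omega
  have e3 : j - 1 + 2 = j + 1 := by omega
  have e4 : n - (j - 1) = n + 1 - j := by omega
  have e5 : n + 2 - j = n + 1 - j + 1 := by omega
  rw [e1, e2, PP_succ p a _ (by omega)] at h1
  rw [e3, e4, PP_succ p a _ (by omega)] at h2
  have b1 := ham j (by omega) (by omega)
  have b2 := ham (j + 1) (by omega) (by omega)
  rw [e5]
  obtain ⟨c, hc⟩ : ∃ c, n + 1 - j = j + (c + 1) := ⟨n - 2 * j, by omega⟩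
  rw [hc] at h1 h2 ⊢
  have h3 : (p : ℤ) ^ j * ((a j - a (j + 1) : ℤ) + p * (p ^ c * (a (j + (c + 1)) - a (j + (c + 1) + 1)))) = 0 := by
    rw [pow_add, pow_succ] at h1
    linear_combination h2 - h1
  have h4 := (mul_eq_zero.mp h3).resolve_left (pow_ne_zero _ hp0)
  have h5 : (a j - a (j + 1) : ℤ) = 0 := by
    apply small_dvd (p := p) _ (by omega) (by omega)
    exact ⟨-(p ^ c * (a (j + (c + 1)) - a (j + (c + 1) + 1))), by linear_combination h4⟩
  rw [h5, zero_add] at h4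
  have h6 := (mul_eq_zero.mp ((mul_eq_zero.mp h4).resolve_left hp0)).resolve_left (pow_ne_zero _ hp0)
  omega

theorem arith_all {p n : ℕ} (hp : p.Prime) (a : ℕ → ℕ)
    (ham : ∀ i, 2 ≤ i → i ≤ n → a i ≤ p - 1)
    (H : ∀ s, s + 1 < n → PP p a (s + 2) = PP p a (n - s)) (j : ℕ) (hj : 2 ≤ j)
    (hjn : j < n) : a j = a (j + 1) := by
  have hp0 : (p : ℤ) ≠ 0 := by exact_mod_cast hp.ne_zero
  rcases lt_trichotomy (2 * j) (n + 1) with h | h | h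
  · exact (arith_pair hp a ham H j hj h).1
  · have h1 := H (j - 2) (by omega)
    have e1 : j - 2 + 2 = j := by omega
    have e2 : n - (j - 2) = j + 1 := by omega
    rw [e1, e2, PP_succ p a _ (by omega)] at h1
    have h3 : (p : ℤ) ^ j * (a j - a (j + 1) : ℤ) = 0 := by linarith
    have h4 := (mul_eq_zero.mp h3).resolve_left (pow_ne_zero _ hp0)
    omega
  · have := (arith_pair hp a ham H (n + 1 - j) (by omega) (by omega)).2
    have e1 : n + 1 - (n + 1 - j) = j := by omega
    have e2 : n + 2 - (n + 1 - j) = j + 1 := by omega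
    rwa [e1, e2] at this

theorem arith_const {n : ℕ} (a : ℕ → ℕ) (h : ∀ j, 2 ≤ j → j < n → a j = a (j + 1)) :
    ∀ i, 2 ≤ i → i ≤ n → a i = a 2 := by
  intro i hi
  induction i, hi using Nat.le_induction with
  | base => intro _; rfl
  | succ m hm ih => intro hmn; rw [← h m hm (by omega), ih (by omega)]

theorem dzero {p n : ℕ} (hp : p.Prime) (a : ℕ → ℕ)
    (H : ∀ s, s + 1 < n → ∃ c : ℤ, (c = 0 ∨ c = 1 ∨ c = -1) ∧
      (p : ℤ) ^ s * (PP p a (s + 2) - PP p a (n - s)) = c * p ^ n) (s : ℕ) (hs : s + 1 < n) :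
    PP p a (s + 2) = PP p a (n - s) := by
  have hp0 : (p : ℤ) ≠ 0 := by exact_mod_cast hp.ne_zero
  have H' : ∀ s, s + 1 < n → ∃ c : ℤ, (c = 0 ∨ c = 1 ∨ c = -1) ∧
      (PP p a (s + 2) - PP p a (n - s)) = c * p ^ (n - s) := by
    intro s hs
    obtain ⟨c, hc, h⟩ := H s hs
    refine ⟨c, hc, mul_left_cancel₀ (pow_ne_zero s hp0) ?_⟩
    rw [h]
    have : (p : ℤ) ^ n = p ^ s * p ^ (n - s) := by rw [← pow_add]; congr 1; omega
    rw [this]; ring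
  by_cases he : n - s = s + 2
  · rw [he]
  obtain ⟨c, hc, h⟩ := H' s hs
  obtain ⟨d, hd, h'⟩ := H' (n - s - 2) (by omega)
  have e1 : n - s - 2 + 2 = n - s := by omega
  have e2 : n - (n - s - 2) = s + 2 := by omega
  rw [e1, e2] at h'
  have h3 : c * (p : ℤ) ^ (n - s) = - (d * p ^ (s + 2)) := by linarith
  have hne : (p : ℤ) ^ (n - s) ≠ p ^ (s + 2) := by
    intro hh
    exact he (Nat.pow_right_injective hp.two_le (by exact_mod_cast hh))
  have q1 : (0 : ℤ) < (p : ℤ) ^ (n - s) := by have := hp.pos; positivity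
  have q2 : (0 : ℤ) < (p : ℤ) ^ (s + 2) := by have := hp.pos; positivity
  rcases hc with rfl | rfl | rfl
  · linarith
  · rcases hd with rfl | rfl | rfl
    · linarith
    · linarith
    · exact absurd (by linarith) hne
  · rcases hd with rfl | rfl | rfl
    · linarith
    · exact absurd (by linarith) hne
    · linarith

theorem PP_zero {p n : ℕ} (a : ℕ → ℕ) (h : ∀ i j, 2 ≤ i → i ≤ n → 2 ≤ j → j ≤ n → a i = a j)
    (r : ℕ) (hr : r ≤ n) : PP p a r = 0 := by
  rw [PP]
  apply sum_eq_zero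
  intro l hl
  rw [mem_Ico] at hl
  rw [h l (l + 1) (by omega) (by omega) (by omega) (by omega)]; simp

theorem TT_const {p n : ℕ} (a : ℕ → ℕ) (h : ∀ i j, 2 ≤ i → i ≤ n → 2 ≤ j → j ≤ n → a i = a j)
    (s : ℕ) (hs : s < n) : TT p n a s = TT p n a 0 := by
  induction s with
  | zero => rfl
  | succ m ih =>
    have e : TT p n a (m + 1) =
      TT p n a m + (p : ℤ) ^ m * (PP p a (m + 2) - PP p a (n - m)) := rfl
    rw [e, ih (by omega), PP_zero a h _ (by omega), PP_zero a h _ (by omega)]; simp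

end arith

section fourier
open Finset
variable {p n : ℕ} [NeZero (p ^ n)]

/-- convolution square -/
noncomputable def cv {p n : ℕ} [NeZero (p ^ n)] (f : ZMod (p ^ n) × ZMod (p ^ n) → ℂ)
    (d : ZMod (p ^ n) × ZMod (p ^ n)) : ℂ := ∑ z, f z * f (d - z)

theorem theta_cv (f : ZMod (p ^ n) × ZMod (p ^ n) → ℂ) (y) :
    theta (cv f) y = theta f y ^ 2 := by
  rw [sq]
  simp only [theta, cv, sum_mul]
  rw [sum_comm]
  apply sum_congr rfl
  intro z _
  rw [mul_sum]
  rw [← Equiv.sum_comp (Equiv.addLeft z)]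
  apply sum_congr rfl
  intro x _
  simp only [Equiv.coe_addLeft, add_sub_cancel_left, ee_add_left]
  ring

theorem theta_inv (f : ZMod (p ^ n) × ZMod (p ^ n) → ℂ) (z) :
    ∑ y, theta f y * ee y z = (p : ℂ) ^ (2 * n) * f z := by
  simp only [theta, sum_mul]
  rw [sum_comm]
  have : ∀ x, ∑ y, f x * ee x y * ee y z = f x * if z - x = 0 then (p : ℂ) ^ (2 * n) else 0 := by
    intro x
    rw [← sum_ee, mul_sum]
    apply sum_congr rfl
    intro y _
    rw [sub_eq_add_neg, ee_add_right, ee_neg_swap]; ring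
  simp only [this, sub_eq_zero]
  simp [mul_comm]

theorem theta_inj (hp : p.Prime) (f g : ZMod (p ^ n) × ZMod (p ^ n) → ℂ)
    (h : ∀ y, theta f y = theta g y) (z) : f z = g z := by
  have h1 := theta_inv f z
  simp only [h, theta_inv g z] at h1
  have : (p : ℂ) ≠ 0 := by exact_mod_cast hp.ne_zero
  exact (mul_left_cancel₀ (pow_ne_zero _ this) h1).symm

theorem theta_comb (f : ZMod (p ^ n) × ZMod (p ^ n) → ℂ) (α β γ : ℂ) (y) :
    theta (fun x => α * f x + β + γ * if x = 0 then 1 else 0) y =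
      α * theta f y + β * (if y = 0 then (p : ℂ) ^ (2 * n) else 0) + γ := by
  rw [← sum_ee, theta, theta]
  simp only [add_mul, sum_add_distrib, mul_sum, mul_assoc]
  simp [ee_zero_left]

end fourier

section main
open Finset
variable {p n : ℕ} [NeZero (p ^ n)]

theorem ff_cases (S : Set (AddSubgroup (ZMod (p ^ n) × ZMod (p ^ n)))) (x) :
    ff S x = 0 ∨ ff S x = 1 := by
  rw [ff]; split_ifs <;> simp

theorem card_tors1 (hp : p.Prime) (hn : 1 ≤ n) :
    #{t : ZMod (p ^ n) × ZMod (p ^ n) | p • t = 0} = p ^ 2 := by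
  have := card_torsion (p := p) (n := n) (l := 1) hn
  simpa using this

theorem exists_lift (hp : p.Prime) (hn : 1 ≤ n) (a : ℕ → ℕ)
    (ham : ∀ i, 2 ≤ i → i ≤ n → a i ≤ p - 1)
    (S : Set (AddSubgroup (ZMod (p ^ n) × ZMod (p ^ n)))) (hS : IsHomog p n S a) (z)
    (hz : 1 ≤ lev p n z) (hzn : lev p n z < n) :
    ∃ y, lev p n y = lev p n z + 1 ∧ ff S y = ff S z := by
  have hp2 := hp.two_le
  obtain ⟨w, hw⟩ := exists_div (p := p) (n := n) (l := 1) hp hn z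
    ((lev_le_iff hp z _).mp (by omega))
  rw [pow_one] at hw
  have hlw : lev p n w = lev p n z + 1 := by
    have := lev_nsmul hp w
    rw [← hw] at this; omega
  have HF := ff_HF hp hn a S hS w
  rw [← hw, gg, if_neg (by omega)] at HF
  by_contra! hcon
  have key : ∀ t, p • t = 0 → ff S (w + t) ≠ ff S z := by
    intro t ht
    exact hcon _ (by rw [lev_add hp w t (by omega) ht, hlw])
  have hb := ham (lev p n w) (by omega) (by omega)
  rcases ff_cases S z with h | h
  · have e : ∑ t with p • t = 0, ff S (w + t) = ∑ t : ZMod (p ^ n) × ZMod (p ^ n) with p • t = 0, (1 : ℂ) := by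
      apply sum_congr rfl
      intro t ht
      have := key t (mem_filter.mp ht).2
      rw [h] at this
      exact (ff_cases S _).resolve_left this
    rw [e, h, sum_const, card_tors1 hp hn] at HF
    have HF' : p ^ 2 = p * a (lev p n w) := by
      have : ((p ^ 2 : ℕ) : ℂ) = ((p * a (lev p n w) : ℕ) : ℂ) := by simpa using HF
      exact_mod_cast this
    rw [sq] at HF'
    have := Nat.eq_of_mul_eq_mul_left hp.pos HF'
    omega
  · have e : ∑ t with p • t = 0, ff S (w + t) = 0 := by
      apply sum_eq_zero
      intro t ht
      have := key t (mem_filter.mp ht).2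
      rw [h] at this
      exact (ff_cases S _).resolve_right this
    rw [e, h] at HF
    have HF' : 0 = p + p * a (lev p n w) := by
      have : ((0 : ℕ) : ℂ) = ((p + p * a (lev p n w) : ℕ) : ℂ) := by simpa using HF
      exact_mod_cast this
    omega

theorem exists_lift_top (hp : p.Prime) (hn : 1 ≤ n) (a : ℕ → ℕ)
    (ham : ∀ i, 2 ≤ i → i ≤ n → a i ≤ p - 1)
    (S : Set (AddSubgroup (ZMod (p ^ n) × ZMod (p ^ n)))) (hS : IsHomog p n S a) (k : ℕ) :
    ∀ z, 1 ≤ lev p n z → lev p n z + k = n → ∃ y, lev p n y = n ∧ ff S y = ff S z := by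
  induction k with
  | zero => intro z _ h; exact ⟨z, h, rfl⟩
  | succ k ih =>
    intro z h1 h2
    obtain ⟨y, hy, hf⟩ := exists_lift hp hn a ham S hS z h1 (by omega)
    obtain ⟨x, hx, hf'⟩ := ih y (by omega) (by omega)
    exact ⟨x, hx, hf'.trans hf⟩

theorem exists_lev (hp : p.Prime) (m : ℕ) (hm : m ≤ n) :
    ∃ z : ZMod (p ^ n) × ZMod (p ^ n), lev p n z = m := by
  have key : ∀ k, k ≤ n → ∃ z : ZMod (p ^ n) × ZMod (p ^ n), lev p n z = n - k := by
    intro k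
    induction k with
    | zero =>
      intro _
      refine ⟨(1, 0), ?_⟩
      have h : addOrderOf ((1, 0) : ZMod (p ^ n) × ZMod (p ^ n)) = p ^ n := by
        rw [Prod.addOrderOf]; simp
      rw [lev, h, hp.factorization_pow]; simp
    | succ k ih =>
      intro hk
      obtain ⟨z, hz⟩ := ih (by omega)
      exact ⟨p • z, by rw [lev_nsmul hp, hz]; omega⟩
  obtain ⟨z, hz⟩ := key (n - m) (by omega)
  exact ⟨z, by omega⟩

theorem theta_ff (hp : p.Prime) (hn : 1 ≤ n) (a : ℕ → ℕ)
    (S : Set (AddSubgroup (ZMod (p ^ n) × ZMod (p ^ n)))) (hS : IsHomog p n S a)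
    (s : ℕ) (hs : s < n) (y) (hy : lev p n y = n - s) :
    theta (ff S) y = (p : ℂ) ^ n * ff S y + (TT p n a s : ℤ) :=
  theta_formula hp hn (ff S) a (ff_unit S) (ff_HF hp hn a S hS) s hs y hy

theorem ff_zero (a : ℕ → ℕ)
    (S : Set (AddSubgroup (ZMod (p ^ n) × ZMod (p ^ n)))) (hS : IsHomog p n S a) :
    ff S 0 = 0 := by
  rw [ff, if_neg]
  rw [AddSubgroup.zmultiples_zero_eq_bot]; exact hS.1

theorem one_le_lev (hp : p.Prime) (z : ZMod (p ^ n) × ZMod (p ^ n)) (hz : z ≠ 0) :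
    1 ≤ lev p n z := by
  by_contra h
  exact hz ((lev_eq_zero hp z).mp (by omega))

theorem ne_zero_of_lev (hp : p.Prime) (z : ZMod (p ^ n) × ZMod (p ^ n)) (hz : 1 ≤ lev p n z) :
    z ≠ 0 := by
  intro h
  have := (lev_eq_zero hp z).mpr h
  omega

theorem theta_diff (hp : p.Prime) (hn : 1 ≤ n) (a : ℕ → ℕ)
    (ham : ∀ i, 2 ≤ i → i ≤ n → a i ≤ p - 1)
    (S : Set (AddSubgroup (ZMod (p ^ n) × ZMod (p ^ n)))) (hS : IsHomog p n S a)
    (A B : ℂ) (hq : ∀ y, y ≠ 0 → theta (ff S) y ^ 2 = A + B * theta (ff S) y)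
    (y z) (hy : y ≠ 0) (hz : z ≠ 0) :
    ∃ c : ℤ, (c = 0 ∨ c = 1 ∨ c = -1) ∧ theta (ff S) z - theta (ff S) y = c * (p : ℂ) ^ n := by
  by_cases h1 : ∃ x, x ≠ 0 ∧ ff S x = 1
  · by_cases h0 : ∃ x, x ≠ 0 ∧ ff S x = 0
    · obtain ⟨x1, hx1, hf1⟩ := h1
      obtain ⟨x0, hx0, hf0⟩ := h0
      obtain ⟨y1, hy1, hg1⟩ := exists_lift_top hp hn a ham S hS _ x1 (one_le_lev hp _ hx1)
        (Nat.add_sub_cancel' (lev_le hp x1))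
      obtain ⟨y0, hy0, hg0⟩ := exists_lift_top hp hn a ham S hS _ x0 (one_le_lev hp _ hx0)
        (Nat.add_sub_cancel' (lev_le hp x0))
      have t1 := theta_ff hp hn a S hS 0 (by omega) y1 (by omega)
      have t0 := theta_ff hp hn a S hS 0 (by omega) y0 (by omega)
      have q1 := hq y1 (ne_zero_of_lev hp _ (by omega))
      have q0 := hq y0 (ne_zero_of_lev hp _ (by omega))
      rw [hg1, hf1, mul_one] at t1
      rw [hg0, hf0, mul_zero, zero_add] at t0
      rw [t1] at q1
      rw [t0] at q0
      have hpn : (p : ℂ) ^ n ≠ 0 := pow_ne_zero _ (by exact_mod_cast hp.ne_zero)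
      have hB : (p : ℂ) ^ n + 2 * (TT p n a 0 : ℤ) = B := by
        apply mul_left_cancel₀ hpn
        linear_combination q1 - q0
      have key : ∀ x, x ≠ 0 → theta (ff S) x = (TT p n a 0 : ℤ) ∨
          theta (ff S) x = (p : ℂ) ^ n + (TT p n a 0 : ℤ) := by
        intro x hx
        have q := hq x hx
        have : (theta (ff S) x - (TT p n a 0 : ℤ)) *
            (theta (ff S) x - ((p : ℂ) ^ n + (TT p n a 0 : ℤ))) = 0 := by
          linear_combination q - q0 + (-theta (ff S) x + (TT p n a 0 : ℤ)) * hB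
        rcases mul_eq_zero.mp this with h | h
        · left; linear_combination h
        · right; linear_combination h
      rcases key y hy with h | h <;> rcases key z hz with h' | h' <;> rw [h, h']
      · exact ⟨0, by simp, by simp⟩
      · exact ⟨1, by simp, by simp⟩
      · exact ⟨-1, by simp, by simp⟩
      · exact ⟨0, by simp, by simp⟩
    · push Not at h0
      have e : ff S = fun x => 0 * ff S x + 1 + (-1) * if x = 0 then 1 else 0 := by
        funext x
        by_cases hx : x = 0
        · rw [hx, ff_zero a S hS]; simp
        · rw [(ff_cases S x).resolve_left (h0 x hx)]; simp [hx]
      have q : ∀ x, x ≠ 0 → theta (ff S) x = -1 := by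
        intro x hx
        rw [e, theta_comb]; simp [hx]
      exact ⟨0, by simp, by rw [q y hy, q z hz]; simp⟩
  · push Not at h1
    have e : ff S = fun x => 0 * ff S x + 0 + 0 * if x = 0 then 1 else 0 := by
      funext x
      by_cases hx : x = 0
      · rw [hx, ff_zero a S hS]; simp
      · rw [(ff_cases S x).resolve_right (h1 x hx)]; simp
    have q : ∀ x, x ≠ 0 → theta (ff S) x = 0 := by
      intro x hx
      rw [e, theta_comb]; simp
    exact ⟨0, by simp, by rw [q y hy, q z hz]; simp⟩

theorem forward_dir (hp : p.Prime) (hn : 1 ≤ n) (a : ℕ → ℕ)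
    (ham : ∀ i, 2 ≤ i → i ≤ n → a i ≤ p - 1)
    (S : Set (AddSubgroup (ZMod (p ^ n) × ZMod (p ^ n)))) (hS : IsHomog p n S a)
    (k l m : ℂ) (hk : cv (ff S) 0 = k) (hl : ∀ d, ff S d = 1 → cv (ff S) d = l)
    (hm : ∀ d, d ≠ 0 → ff S d = 0 → cv (ff S) d = m) :
    ∀ i j, 2 ≤ i → i ≤ n → 2 ≤ j → j ≤ n → a i = a j := by
  have e : cv (ff S) = fun x => (l - m) * ff S x + m + (k - m) * if x = 0 then 1 else 0 := by
    funext x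
    by_cases hx : x = 0
    · rw [hx, ff_zero a S hS, hk]; simp
    · rcases ff_cases S x with h | h
      · rw [h, hm x hx h]; simp [hx]
      · rw [h, hl x h]; simp [hx]
  have hq : ∀ y, y ≠ 0 → theta (ff S) y ^ 2 = (k - m) + (l - m) * theta (ff S) y := by
    intro y hy
    rw [← theta_cv, e, theta_comb, if_neg hy]; ring
  have H : ∀ s, s + 1 < n → ∃ c : ℤ, (c = 0 ∨ c = 1 ∨ c = -1) ∧
      (p : ℤ) ^ s * (PP p a (s + 2) - PP p a (n - s)) = c * p ^ n := by
    intro s hs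
    obtain ⟨z, hz⟩ := exists_lev (p := p) (n := n) hp (n - (s + 1)) (by omega)
    obtain ⟨y, hy, hf⟩ := exists_lift hp hn a ham S hS z (by omega) (by omega)
    obtain ⟨c, hc, h⟩ := theta_diff hp hn a ham S hS _ _ hq y z
      (ne_zero_of_lev hp _ (by omega)) (ne_zero_of_lev hp _ (by omega))
    refine ⟨c, hc, ?_⟩
    rw [theta_ff hp hn a S hS (s + 1) (by omega) z hz, theta_ff hp hn a S hS s (by omega) y
      (by omega), hf] at h
    have e : TT p n a (s + 1) =
      TT p n a s + (p : ℤ) ^ s * (PP p a (s + 2) - PP p a (n - s)) := rfl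
    have h2 : ((TT p n a (s + 1) - TT p n a s : ℤ) : ℂ) = ((c * (p : ℤ) ^ n : ℤ) : ℂ) := by
      push_cast; linear_combination h
    have h3 : TT p n a (s + 1) - TT p n a s = c * (p : ℤ) ^ n := by exact_mod_cast h2
    linarith
  have hall := arith_const a (arith_all hp a ham (dzero hp a H))
  intro i j hi hin hj hjn
  rw [hall i hi hin, hall j hj hjn]

theorem reverse_dir (hp : p.Prime) (hn : 1 ≤ n) (a : ℕ → ℕ)
    (S : Set (AddSubgroup (ZMod (p ^ n) × ZMod (p ^ n)))) (hS : IsHomog p n S a)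
    (h : ∀ i j, 2 ≤ i → i ≤ n → 2 ≤ j → j ≤ n → a i = a j) :
    ∃ α β : ℂ, ∀ d, d ≠ 0 → cv (ff S) d = α * ff S d + β := by
  have ht : ∀ y, y ≠ 0 → theta (ff S) y = (p : ℂ) ^ n * ff S y + (TT p n a 0 : ℤ) := by
    intro y hy
    have h1 := one_le_lev hp y hy
    have h2 := lev_le hp y
    rw [theta_ff hp hn a S hS (n - lev p n y) (by omega) y (by omega), TT_const a h _ (by omega)]
  have hpn : (p : ℂ) ^ (2 * n) ≠ 0 := pow_ne_zero _ (by exact_mod_cast hp.ne_zero)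
  obtain ⟨τ, hτ⟩ : ∃ τ : ℂ, τ = ((TT p n a 0 : ℤ) : ℂ) := ⟨_, rfl⟩
  rw [← hτ] at ht
  obtain ⟨γ, hγ⟩ : ∃ γ : ℂ, γ = - τ * ((p : ℂ) ^ n + τ) := ⟨_, rfl⟩
  obtain ⟨α, hα⟩ : ∃ α : ℂ, α = (p : ℂ) ^ n + 2 * τ := ⟨_, rfl⟩
  refine ⟨α, (theta (ff S) 0 ^ 2 - α * theta (ff S) 0 - γ) / (p : ℂ) ^ (2 * n), ?_⟩
  intro d hd
  have := theta_inj hp (cv (ff S)) (fun x => α * ff S x +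
    (theta (ff S) 0 ^ 2 - α * theta (ff S) 0 - γ) / (p : ℂ) ^ (2 * n) +
      γ * if x = 0 then 1 else 0) ?_ d
  · rw [this]; simp [hd]
  · intro y
    rw [theta_cv, theta_comb]
    by_cases hy : y = 0
    · rw [hy, if_pos rfl, div_mul_cancel₀ _ hpn]; ring
    · rw [if_neg hy, ht y hy, hα, hγ]
      rcases ff_cases S y with h | h <;> rw [h] <;> ring

open SimpleGraph in
theorem adj_iff (a : ℕ → ℕ)
    (S : Set (AddSubgroup (ZMod (p ^ n) × ZMod (p ^ n)))) (hS : IsHomog p n S a) (v w) :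
    (circulantGraph {g : ZMod (p ^ n) × ZMod (p ^ n) |
          AddSubgroup.zmultiples g ∈ S}).Adj v w ↔ AddSubgroup.zmultiples (w - v) ∈ S := by
  have h : AddSubgroup.zmultiples (v - w) = AddSubgroup.zmultiples (w - v) := by
    rw [← AddSubgroup.zmultiples_neg, neg_sub]
  rw [circulantGraph_adj]
  simp only [Set.mem_ofPred_eq, h, or_self, and_iff_right_iff_imp]
  rintro hvw rfl
  rw [sub_self, AddSubgroup.zmultiples_zero_eq_bot] at hvw
  exact hS.1 hvw

open SimpleGraph in
open scoped Classical in
theorem common_card (a : ℕ → ℕ)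
    (S : Set (AddSubgroup (ZMod (p ^ n) × ZMod (p ^ n)))) (hS : IsHomog p n S a) (v w) :
    (Fintype.card ((circulantGraph {g : ZMod (p ^ n) × ZMod (p ^ n) |
          AddSubgroup.zmultiples g ∈ S}).commonNeighbors v w) : ℂ) = cv (ff S) (w - v) := by
  rw [cv, ← Equiv.sum_comp (Equiv.subRight v), ← Nat.card_eq_fintype_card, Nat.card_coe_set_eq,
    Set.ncard_eq_toFinset_card']
  have : ∀ u, ff S (Equiv.subRight v u) * ff S (w - v - Equiv.subRight v u) =
      if u ∈ (circulantGraph {g : ZMod (p ^ n) × ZMod (p ^ n) |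
          AddSubgroup.zmultiples g ∈ S}).commonNeighbors v w then 1 else 0 := by
    intro u
    have h : AddSubgroup.zmultiples (u - w) = AddSubgroup.zmultiples (w - u) := by
      rw [← AddSubgroup.zmultiples_neg, neg_sub]
    simp only [mem_commonNeighbors, adj_iff a S hS, h]
    simp only [Equiv.subRight_apply, sub_sub_sub_cancel_right, ff]
    split_ifs <;> simp_all
  simp only [this, sum_boole]
  congr 2
  ext u; simp

open SimpleGraph in
open scoped Classical in
theorem degree_card (a : ℕ → ℕ)
    (S : Set (AddSubgroup (ZMod (p ^ n) × ZMod (p ^ n)))) (hS : IsHomog p n S a) (v) :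
    (circulantGraph {g : ZMod (p ^ n) × ZMod (p ^ n) |
          AddSubgroup.zmultiples g ∈ S}).degree v = #{x : ZMod (p ^ n) × ZMod (p ^ n) |
          AddSubgroup.zmultiples x ∈ S} := by
  rw [← card_neighborFinset_eq_degree]
  apply card_bij' (fun u _ => u - v) (fun x _ => x + v)
  · intro u hu
    rw [mem_neighborFinset, adj_iff a S hS] at hu
    simpa using hu
  · intro x hx
    rw [mem_neighborFinset, adj_iff a S hS]
    simpa using hx
  · intro u _; simp
  · intro u _; simp

end main

open SimpleGraph in
open scoped Classical in
/-- for an `(a 1, ..., a n)`-homogeneous set `S ⊆ Δ`, the Cayley graph on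
`G = ℤ_{pⁿ} ⊕ ℤ_{pⁿ}` with connection set `⋃_{F ∈ S} O_F` is strongly regular iff
`a 2 = a 3 = ⋯ = a n`. -/
theorem stmt_17 (p : ℕ) (hp : p.Prime) (n : ℕ) (hn : 1 ≤ n) [NeZero (p ^ n)]
    (a : ℕ → ℕ) (ha1 : a 1 ≤ p + 1) (ham : ∀ i, 2 ≤ i → i ≤ n → a i ≤ p - 1)
    (S : Set (AddSubgroup (ZMod (p ^ n) × ZMod (p ^ n))))
    (hScyc : ∀ F ∈ S, IsCyc p n F) (hS : IsHomog p n S a) :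
    (∃ k ℓ μ : ℕ,
      (circulantGraph {g : ZMod (p ^ n) × ZMod (p ^ n) |
          AddSubgroup.zmultiples g ∈ S}).IsSRGWith (p ^ (2 * n)) k ℓ μ) ↔
    (∀ i j, 2 ≤ i → i ≤ n → 2 ≤ j → j ≤ n → a i = a j) := by
  have ff1 : ∀ x, ff S x = 1 ↔ AddSubgroup.zmultiples x ∈ S := by
    intro x; rw [ff]; split_ifs with h <;> simp [h]
  have ff0 : ∀ x, ff S x = 0 ↔ AddSubgroup.zmultiples x ∉ S := by
    intro x; rw [ff]; split_ifs with h <;> simp [h]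
  constructor
  · rintro ⟨k, l, m, h⟩
    refine forward_dir hp hn a ham S hS (cv (ff S) 0) l m rfl ?_ ?_
    · intro d hd
      have h1 := h.of_adj 0 d (by rw [adj_iff a S hS, sub_zero]; exact (ff1 d).mp hd)
      have h2 := common_card a S hS 0 d
      rw [sub_zero] at h2
      rw [← h2, ← h1]
    · intro d hd0 hd
      have h1 := h.of_not_adj (Ne.symm hd0)
        (by rw [adj_iff a S hS, sub_zero]; exact (ff0 d).mp hd)
      have h2 := common_card a S hS 0 d
      rw [sub_zero] at h2
      rw [← h2, ← h1]
  · intro h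
    obtain ⟨α, β, hc⟩ := reverse_dir hp hn a S hS h
    have e1 : ∃ l : ℕ, ∀ d, AddSubgroup.zmultiples d ∈ S → cv (ff S) d = l := by
      by_cases hex : ∃ d, AddSubgroup.zmultiples d ∈ S
      · obtain ⟨d0, hd0⟩ := hex
        have hne : ∀ d, AddSubgroup.zmultiples d ∈ S → d ≠ 0 := by
          rintro d hd rfl
          rw [AddSubgroup.zmultiples_zero_eq_bot] at hd
          exact hS.1 hd
        have h2 := common_card a S hS 0 d0
        rw [sub_zero] at h2
        refine ⟨_, fun d hd => Eq.trans ?_ h2.symm⟩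
        rw [hc d (hne d hd), hc d0 (hne d0 hd0), (ff1 d).mpr hd, (ff1 d0).mpr hd0]
      · exact ⟨0, fun d hd => absurd ⟨d, hd⟩ hex⟩
    have e0 : ∃ m : ℕ, ∀ d, d ≠ 0 → AddSubgroup.zmultiples d ∉ S → cv (ff S) d = m := by
      by_cases hex : ∃ d, d ≠ 0 ∧ AddSubgroup.zmultiples d ∉ S
      · obtain ⟨d0, hd0, hd0'⟩ := hex
        have h2 := common_card a S hS 0 d0
        rw [sub_zero] at h2
        refine ⟨_, fun d hd hd' => Eq.trans ?_ h2.symm⟩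
        rw [hc d hd, hc d0 hd0, (ff0 d).mpr hd', (ff0 d0).mpr hd0']
      · exact ⟨0, fun d hd hd' => absurd ⟨d, hd, hd'⟩ hex⟩
    obtain ⟨l, hl⟩ := e1
    obtain ⟨m, hm⟩ := e0
    refine ⟨Finset.card {x : ZMod (p ^ n) × ZMod (p ^ n) | AddSubgroup.zmultiples x ∈ S}, l, m,
      ?_, ?_, ?_, ?_⟩
    · rw [Fintype.card_prod, ZMod.card, two_mul, pow_add]
    · intro v
      rw [← degree_card a S hS v]
    · intro v w hvw
      rw [adj_iff a S hS] at hvw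
      have h2 := (common_card a S hS v w).trans (hl _ hvw)
      rw [← Nat.cast_inj (R := ℂ), ← h2]
    · intro v w hne hvw
      rw [adj_iff a S hS] at hvw
      have h2 := (common_card a S hS v w).trans (hm _ (sub_ne_zero.mpr hne.symm) hvw)
      rw [← Nat.cast_inj (R := ℂ), ← h2]
end
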